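/- For every α ∈ G, the element α is (H, G₁)-negative if and only if ι(α) is r₁-negative in the braid group B_{2k}. -/

import Mathlib

namespace GarsideOrder

variable {G : Type*} [Group G]

/-- `a ≤_R b` iff `b * a⁻¹ ∈ M`. -/
def leR (M : Submonoid G) (a b : G) : Prop := b * a⁻¹ ∈ M

/-- `a ≤_L b` iff `a⁻¹ * b ∈ M`. -/
def leL (M : Submonoid G) (a b : G) : Prop := a⁻¹ * b ∈ M

/-- Right divisors (in `M`) of `a`. -/
def DivR (M : Submonoid G) (a : G) : Set G := {b : G | b ∈ M ∧ leR M b a}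

/-- Left divisors (in `M`) of `a`. -/
def DivL (M : Submonoid G) (a : G) : Set G := {b : G | b ∈ M ∧ leL M b a}

/-- `a` is balanced if its sets of right and left divisors coincide. -/
def Balanced (M : Submonoid G) (a : G) : Prop := DivR M a = DivL M a

open Classical in
/-- The `N`-tail of `a`: the unique `b ∈ N` having the same right divisors lying in `N`
as `a` (w.r.t. the divisibility of the ambient monoid `M`). -/
noncomputable def tail (M N : Submonoid G) (a : G) : G :=
  if h : ∃ b : G, b ∈ N ∧
      {c : G | c ∈ N ∧ leR M c a} = {c : G | c ∈ N ∧ leR M c b} then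
    h.choose
  else 1

/-- Iterated stripping of alternating tails: first the `M₁`-tail, then the `N`-tail, etc. -/
noncomputable def strip (M M₁ N : Submonoid G) : ℕ → G → G
  | 0, a => a
  | i + 1, a =>
      strip M M₁ N i a *
        (tail M (if i % 2 = 0 then M₁ else N) (strip M M₁ N i a))⁻¹

/-- The breadth of `a`: the length of the alternating form of `a`, i.e. the least `p ≥ 1`
such that stripping alternating tails `p` times reaches `1`. -/
noncomputable def bh (M M₁ N : Submonoid G) (a : G) : ℕ :=
  sInf {p : ℕ | 1 ≤ p ∧ strip M M₁ N p a = 1}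

/-- The depth of `a`: `(bh a - 1)/2` if `bh a` is odd, `bh a / 2` if `bh a` is even;
in both cases this is `bh a / 2` with natural division. -/
noncomputable def dpt (M M₁ N : Submonoid G) (a : G) : ℕ := bh M M₁ N a / 2

/-- `a ∈ M` is unmovable if `Δ` does not right-divide it. -/
def Unmovable (M : Submonoid G) (Δ a : G) : Prop := a ∈ M ∧ ¬ leR M Δ a

/-- `α` is `(H, G₁)`-negative: its `Δ`-form is `a Δ^{-k}` with `k ≥ 1` and
`dpt a < dpt (Δ^k)`. -/
def Negative (M M₁ N : Submonoid G) (Δ : G) (α : G) : Prop :=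
  ∃ a : G, ∃ k : ℕ, Unmovable M Δ a ∧ 1 ≤ k ∧ α = a * (Δ ^ k)⁻¹ ∧
    dpt M M₁ N a < dpt M M₁ N (Δ ^ k)

/-- `α` is `(H, G₁)`-positive if `α⁻¹` is `(H, G₁)`-negative. -/
def Positive (M M₁ N : Submonoid G) (Δ : G) (α : G) : Prop :=
  Negative M M₁ N Δ α⁻¹

/-- The set `Θ` of theta elements `θ^k a₀`, `k ≥ 1`, `a₀ ∈ M₁`. -/
def thetaSet (M₁ : Submonoid G) (θ : G) : Set G :=
  {x : G | ∃ k : ℕ, 1 ≤ k ∧ ∃ a₀ ∈ M₁, x = θ ^ k * a₀}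

/-- `Θ̄ = Θ ∪ M₁`. -/
def thetaBar (M₁ : Submonoid G) (θ : G) : Set G := thetaSet M₁ θ ∪ (M₁ : Set G)

/-- Condition A with constant `ζ`: `dpt (Δ^k) = ζ k + 1` for all `k ≥ 1`. -/
def CondA (M M₁ N : Submonoid G) (Δ : G) (ζ : ℕ) : Prop :=
  ∀ k : ℕ, 1 ≤ k → dpt M M₁ N (Δ ^ k) = ζ * k + 1

/-- Condition B with constant `ζ`. -/
def CondB (M M₁ N : Submonoid G) (Δ θ : G) (ζ : ℕ) : Prop :=
  ∀ a b c : G, ∀ t : ℤ,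
    Unmovable M Δ a → Unmovable M Δ b →
    ¬(a ∈ thetaBar M₁ θ ∧ b ∈ thetaBar M₁ θ) →
    Unmovable M Δ c → a * b = c * Δ ^ t →
    ∃ ε : ℕ, ε ≤ 1 ∧
      (dpt M M₁ N c : ℤ) =
        (dpt M M₁ N a : ℤ) + (dpt M M₁ N b : ℤ) - (ζ : ℤ) * t - (ε : ℤ) ∧
      ((a ∈ thetaSet M₁ θ ∨ b ∈ thetaSet M₁ θ ∨ c ∈ M₁) → ε = 1)

/-- A Garside structure with group of fractions the subgroup `car`. -/
structure IsGarsideOn (car : Subgroup G) (M : Submonoid G) (Δ : G) : Prop where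
  M_sub : (M : Set G) ⊆ (car : Set G)
  delta_mem : Δ ∈ M
  units_trivial : ∀ x : G, x ∈ M → x⁻¹ ∈ M → x = 1
  noetherian : ∀ a ∈ M, ∃ n : ℕ, 1 ≤ n ∧ ∀ l : List G,
      (∀ x ∈ l, x ∈ M ∧ x ≠ 1) → l.prod = a → l.length ≤ n
  balanced : Balanced M Δ
  div_finite : (DivR M Δ).Finite
  div_gen_monoid : Submonoid.closure (DivR M Δ) = M
  div_gen_group : Subgroup.closure (DivR M Δ) = car
  meet : ∀ a ∈ car, ∀ b ∈ car, ∃ c ∈ car, leR M c a ∧ leR M c b ∧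
      ∀ d ∈ car, leR M d a → leR M d b → leR M d c
  join : ∀ a ∈ car, ∀ b ∈ car, ∃ c ∈ car, leR M a c ∧ leR M b c ∧
      ∀ d ∈ car, leR M a d → leR M b d → leR M c d

/-- The parabolic submonoid determined by `δ`: the submonoid generated by `Div(δ)`. -/
def parM (M : Submonoid G) (δ : G) : Submonoid G := Submonoid.closure (DivR M δ)

/-- The parabolic subgroup determined by `δ`: the subgroup generated by `Div(δ)`. -/
def parG (M : Submonoid G) (δ : G) : Subgroup G := Subgroup.closure (DivR M δ)

/-- `δ` determines a parabolic substructure of `(G, M, Δ)`. -/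
structure IsParabolic (M : Submonoid G) (Δ δ : G) : Prop where
  mem : δ ∈ M
  balanced : Balanced M δ
  div_eq : DivR M δ = DivR M Δ ∩ (parM M δ : Set G)

/-- The setting of Section 3: a Garside structure `(car, M, Δ)` together with two
parabolic substructures `(H, N, Λ)` (given by `lam`) and `(G₁, M₁, Δ₁)` (given by `δ1`),
with `N ≠ M`, `M₁ ≠ M`, `N ∪ M₁` generating `M`, `Δ` central, `Δ₁` central in `G₁`. -/
structure Setting (G : Type*) [Group G] where
  car : Subgroup G
  M : Submonoid G
  Δ : G
  δ1 : G
  lam : G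
  garside : IsGarsideOn car M Δ
  par1 : IsParabolic M Δ δ1
  parH : IsParabolic M Δ lam
  N_ne : parM M lam ≠ M
  M1_ne : parM M δ1 ≠ M
  unionGen : Submonoid.closure ((parM M lam : Set G) ∪ (parM M δ1 : Set G)) = M
  delta_central : ∀ g ∈ car, Δ * g = g * Δ
  delta1_central : ∀ g ∈ parG M δ1, δ1 * g = g * δ1

namespace Setting

variable (S : Setting G)

/-- The parabolic submonoid `M₁`. -/
def M₁ : Submonoid G := parM S.M S.δ1

/-- The parabolic submonoid `N`. -/
def Nsub : Submonoid G := parM S.M S.lam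

/-- The parabolic subgroup `G₁`. -/
def G₁ : Subgroup G := parG S.M S.δ1

/-- `θ = Δ Δ₁⁻¹`. -/
def theta : G := S.Δ * S.δ1⁻¹

/-- The set of `(H, G₁)`-negative elements. -/
def Neg : Set G := {α : G | Negative S.M S.M₁ S.Nsub S.Δ α}

/-- The set of `(H, G₁)`-positive elements. -/
def Pos : Set G := {α : G | α⁻¹ ∈ S.Neg}

/-- Condition A. -/
def condA (ζ : ℕ) : Prop := CondA S.M S.M₁ S.Nsub S.Δ ζ

/-- Condition B. -/
def condB (ζ : ℕ) : Prop := CondB S.M S.M₁ S.Nsub S.Δ S.theta ζ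

/-- `(H, G₁)` is a Dehornoy structure: `PP ⊆ P`, `G₁ P G₁ ⊆ P`, and the group is the
disjoint union of `P`, `P⁻¹` and `G₁`. -/
def IsDehornoy : Prop :=
  (∀ α ∈ S.Pos, ∀ β ∈ S.Pos, α * β ∈ S.Pos) ∧
  (∀ g₁ ∈ S.G₁, ∀ α ∈ S.Pos, ∀ g₂ ∈ S.G₁, g₁ * α * g₂ ∈ S.Pos) ∧
  (∀ α ∈ S.car, α ∈ S.Pos ∨ α ∈ S.Neg ∨ α ∈ S.G₁) ∧
  (∀ α : G, ¬(α ∈ S.Pos ∧ α ∈ S.Neg)) ∧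
  (∀ α : G, ¬(α ∈ S.Pos ∧ α ∈ S.G₁)) ∧
  (∀ α : G, ¬(α ∈ S.Neg ∧ α ∈ S.G₁))

end Setting

end GarsideOrder


namespace BraidOrder

open GarsideOrder

/-- The braid relations on `n` generators `σ_0, …, σ_{n-1}` (representing `s_1, …, s_n`). -/
def braidRel (n : ℕ) : Set (FreeGroup (Fin n)) :=
  {r | ∃ i j : Fin n,
      ((i : ℕ) + 1 = (j : ℕ) ∧
        r = FreeGroup.of i * FreeGroup.of j * FreeGroup.of i *
            (FreeGroup.of j * FreeGroup.of i * FreeGroup.of j)⁻¹) ∨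
      ((i : ℕ) + 2 ≤ (j : ℕ) ∧
        r = FreeGroup.of i * FreeGroup.of j * (FreeGroup.of j * FreeGroup.of i)⁻¹)}

/-- The braid group `B_{n+1}` on `n+1` strands, presented with `n` generators. -/
abbrev Braid (n : ℕ) := PresentedGroup (braidRel n)

/-- `gen n i` is the generator `s_{i+1}` of `B_{n+1}` (for `i < n`). -/
def gen (n i : ℕ) : Braid n :=
  if h : i < n then PresentedGroup.of ⟨i, h⟩ else 1

/-- The product `gen a * gen (a+1) * ⋯ * gen (b-1)`, i.e. `s_{a+1} s_{a+2} ⋯ s_b`. -/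
def seg (n a b : ℕ) : Braid n := (((List.range b).drop a).map (gen n)).prod

/-- The product `gen (b-1) * ⋯ * gen (a+1) * gen a`, i.e. `s_b ⋯ s_{a+2} s_{a+1}`. -/
def segRev (n a b : ℕ) : Braid n := ((((List.range b).drop a).reverse).map (gen n)).prod

/-- The positive braid monoid `B_{n+1}^+`. -/
def Mb (n : ℕ) : Submonoid (Braid n) :=
  Submonoid.closure {x : Braid n | ∃ i : ℕ, i < n ∧ x = gen n i}

/-- The submonoid generated by `s_2, …, s_n`. -/
def M₁b (n : ℕ) : Submonoid (Braid n) :=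
  Submonoid.closure {x : Braid n | ∃ i : ℕ, 1 ≤ i ∧ i < n ∧ x = gen n i}

/-- The submonoid generated by `s_1, …, s_{n-1}`. -/
def Nb (n : ℕ) : Submonoid (Braid n) :=
  Submonoid.closure {x : Braid n | ∃ i : ℕ, i + 1 < n ∧ x = gen n i}

/-- The subgroup generated by `s_2, …, s_n`. -/
def G₁b (n : ℕ) : Subgroup (Braid n) :=
  Subgroup.closure {x : Braid n | ∃ i : ℕ, 1 ≤ i ∧ i < n ∧ x = gen n i}

/-- The subgroup generated by `s_1, …, s_{n-1}`. -/
def Hb (n : ℕ) : Subgroup (Braid n) :=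
  Subgroup.closure {x : Braid n | ∃ i : ℕ, i + 1 < n ∧ x = gen n i}

/-- The Garside element `Δ = (s_1 s_2 ⋯ s_n)^{n+1}`. -/
def Δb (n : ℕ) : Braid n := seg n 0 n ^ (n + 1)

/-- `Δ₁ = (s_2 ⋯ s_n)^n`. -/
def Δ₁b (n : ℕ) : Braid n := seg n 1 n ^ n

/-- `Λ = (s_1 ⋯ s_{n-1})^n`. -/
def Λb (n : ℕ) : Braid n := seg n 0 (n - 1) ^ n

/-- `θ = s_1 ⋯ s_{n-1} s_n² s_{n-1} ⋯ s_1` as an explicit word. -/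
def thetaWordb (n : ℕ) : Braid n := seg n 0 n * segRev n 0 n

end BraidOrder


namespace DihedralArtin

/-- The alternating word `x y x y ⋯` of length `m`. -/
def alt {α : Type*} [Monoid α] (x y : α) : ℕ → α
  | 0 => 1
  | k + 1 => x * alt y x k

/-- The defining relation of the Artin group of type `I₂(m)`:
`Π(s, t, m) = Π(t, s, m)`, with `s = of true` and `t = of false`. -/
def dihedralRel (m : ℕ) : Set (FreeGroup Bool) :=
  {alt (FreeGroup.of true) (FreeGroup.of false) m *
    (alt (FreeGroup.of false) (FreeGroup.of true) m)⁻¹}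

/-- The Artin group of type `I₂(m)`. -/
abbrev DG (m : ℕ) := PresentedGroup (dihedralRel m)

/-- The generator `s`. -/
def sA (m : ℕ) : DG m := PresentedGroup.of true

/-- The generator `t`. -/
def tA (m : ℕ) : DG m := PresentedGroup.of false

/-- The Artin monoid: the submonoid generated by `{s, t}`. -/
def Md (m : ℕ) : Submonoid (DG m) := Submonoid.closure {sA m, tA m}

/-- The submonoid generated by `t`. -/
def M₁d (m : ℕ) : Submonoid (DG m) := Submonoid.closure {tA m}

/-- The submonoid generated by `s`. -/
def Nd (m : ℕ) : Submonoid (DG m) := Submonoid.closure {sA m}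

/-- The subgroup generated by `t`. -/
def G₁d (m : ℕ) : Subgroup (DG m) := Subgroup.closure {tA m}

/-- The subgroup generated by `s`. -/
def Hd (m : ℕ) : Subgroup (DG m) := Subgroup.closure {sA m}

/-- `Ω = Π(s, t, m)` in the Artin group of type `I₂(m)`. -/
def Ωd (m : ℕ) : DG m := alt (sA m) (tA m) m

end DihedralArtin

namespace BraidOrder

/-- The set of `r₁`-negative elements of `B_{2k}`: elements of the form
`β₀ r₁⁻¹ β₁ ⋯ r₁⁻¹ β_m` with `m ≥ 1` and `β₀, …, β_m ∈ ⟨r₂, …, r_{2k-1}⟩`. -/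
def S1Neg (n : ℕ) : Set (Braid n) :=
  {β : Braid n | ∃ m : ℕ, 1 ≤ m ∧ ∃ b : Fin (m + 1) → Braid n,
      (∀ i, b i ∈ G₁b n) ∧
      β = (List.ofFn (fun i : Fin m => b i.castSucc * (gen n 0)⁻¹)).prod * b (Fin.last m)}

end BraidOrder


namespace BraidOrder

section Dynnikov

/-- Pairs of positive real numbers. -/
abbrev PosPair := {p : ℝ × ℝ // 0 < p.1 ∧ 0 < p.2}

/-- The subtraction-free rational form of Dynnikov's action of a braid generator on two
adjacent pairs of coordinates. -/
noncomputable def dynFun (p : PosPair × PosPair) : PosPair × PosPair :=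
  (⟨(p.1.1.1 * (1 + p.1.1.2) + p.1.1.2 * p.2.1.1,
      p.2.1.1 * p.1.1.2 * p.2.1.2 /
        (p.2.1.1 * p.1.1.2 + p.1.1.1 * (1 + p.1.1.2) * (1 + p.2.1.2))), by
    obtain ⟨⟨⟨x, y⟩, hx, hy⟩, ⟨⟨z, w⟩, hz, hw⟩⟩ := p
    constructor <;> dsimp only at * <;> positivity⟩,
   ⟨(p.1.1.1 * p.2.1.1 * p.2.1.2 / (p.2.1.1 + p.1.1.1 * (1 + p.2.1.2)),
      (p.2.1.1 * p.1.1.2 + p.1.1.1 * (1 + p.1.1.2) * (1 + p.2.1.2)) / p.2.1.1), by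
    obtain ⟨⟨⟨x, y⟩, hx, hy⟩, ⟨⟨z, w⟩, hz, hw⟩⟩ := p
    constructor <;> dsimp only at * <;> positivity⟩)

/-- Inversion of the first coordinate of a pair. -/
noncomputable def flipPair (p : PosPair) : PosPair :=
  ⟨(p.1.1⁻¹, p.1.2), inv_pos.mpr p.2.1, p.2.2⟩

/-- Inversion of both first coordinates conjugates `dynFun` to its inverse. -/
noncomputable def dynInv (p : PosPair × PosPair) : PosPair × PosPair :=
  Prod.map flipPair flipPair (dynFun (Prod.map flipPair flipPair p))

theorem dynInv_dynFun (p : PosPair × PosPair) : dynInv (dynFun p) = p := by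
  obtain ⟨⟨⟨x, y⟩, hx, hy⟩, ⟨⟨z, w⟩, hz, hw⟩⟩ := p
  dsimp only at hx hy hz hw
  simp only [dynInv, dynFun, flipPair, Prod.map, Prod.mk.injEq, Subtype.mk.injEq]
  refine ⟨⟨?_, ?_⟩, ?_, ?_⟩
  all_goals field_simp
  all_goals ring

theorem flipPair_flipPair (p : PosPair) : flipPair (flipPair p) = p := by
  obtain ⟨⟨x, y⟩, hx, hy⟩ := p
  simp [flipPair]

theorem dynFun_dynInv (p : PosPair × PosPair) : dynFun (dynInv p) = p := by
  have h : ∀ q : PosPair × PosPair,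
      Prod.map flipPair flipPair (Prod.map flipPair flipPair q) = q := by
    intro q
    simp [Prod.map, flipPair_flipPair]
  have := dynInv_dynFun (Prod.map flipPair flipPair p)
  unfold dynInv at this ⊢
  rw [← h (dynFun _), this, h]

/-- The action of a braid generator on the `i`-th and `(i+1)`-st pairs. -/
def dynAtFun (f : PosPair × PosPair → PosPair × PosPair) (i : ℕ) (v : ℕ → PosPair) :
    ℕ → PosPair :=
  fun j => if j = i then (f (v i, v (i + 1))).1
    else if j = i + 1 then (f (v i, v (i + 1))).2 else v j

/-- The permutation of coordinate vectors induced by the `i`-th braid generator. -/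
noncomputable def dynAt (i : ℕ) : Equiv.Perm (ℕ → PosPair) where
  toFun := dynAtFun dynFun i
  invFun := dynAtFun dynInv i
  left_inv v := by
    funext j
    by_cases h₁ : j = i
    · subst h₁; simp [dynAtFun, dynInv_dynFun]
    · by_cases h₂ : j = i + 1
      · subst h₂; simp [dynAtFun, dynInv_dynFun]
      · simp [dynAtFun, h₁, h₂]
  right_inv v := by
    funext j
    by_cases h₁ : j = i
    · subst h₁; simp [dynAtFun, dynFun_dynInv]
    · by_cases h₂ : j = i + 1
      · subst h₂; simp [dynAtFun, dynFun_dynInv]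
      · simp [dynAtFun, h₁, h₂]

theorem dynAt_apply (i : ℕ) (v : ℕ → PosPair) (j : ℕ) :
    dynAt i v j = if j = i then (dynFun (v i, v (i + 1))).1
      else if j = i + 1 then (dynFun (v i, v (i + 1))).2 else v j := rfl

theorem dynAt_apply_zero {i : ℕ} (hi : 1 ≤ i) (v : ℕ → PosPair) : dynAt i v 0 = v 0 := by
  rw [dynAt_apply, if_neg (by omega), if_neg (by omega)]

theorem lt_dynAt_zero (v : ℕ → PosPair) : (v 0).1.1 < (dynAt 0 v 0).1.1 := by
  rw [dynAt_apply, if_pos rfl]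
  obtain ⟨hx, hy⟩ := (v 0).2
  obtain ⟨hz, hw⟩ := (v (0 + 1)).2
  have h₁ := mul_pos hx hy
  have h₂ := mul_pos hy hz
  simp only [dynFun]
  linarith

theorem dynAt_comm {i j : ℕ} (h : i + 2 ≤ j) : dynAt i * dynAt j = dynAt j * dynAt i := by
  ext v l : 2
  simp only [Equiv.Perm.mul_apply, dynAt_apply]
  have h₁ : i ≠ j := by omega
  have h₂ : i + 1 ≠ j := by omega
  have h₃ : i ≠ j + 1 := by omega
  have h₄ : j ≠ i := by omega
  have h₅ : j ≠ i + 1 := by omega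
  have h₆ : j + 1 ≠ i := by omega
  have h₇ : j + 1 ≠ i + 1 := by omega
  have h₈ : i + 1 ≠ j + 1 := by omega
  simp only [h₁, h₂, h₃, h₄, h₅, h₆, h₇, h₈, if_false]
  by_cases e₁ : l = i
  · subst e₁; simp [h₁, h₃]
  by_cases e₂ : l = i + 1
  · subst e₂; simp [h₂, h₁]
  simp [e₁, e₂]

theorem dynFun_eq {x y z w a b c d : ℝ} {hp : 0 < x ∧ 0 < y} {hq : 0 < z ∧ 0 < w}
    {ha : 0 < a ∧ 0 < b} {hc : 0 < c ∧ 0 < d}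
    (h₁ : x * (1 + y) + y * z = a)
    (h₂ : z * y * w = b * (z * y + x * (1 + y) * (1 + w)))
    (h₃ : x * z * w = c * (z + x * (1 + w)))
    (h₄ : z * y + x * (1 + y) * (1 + w) = d * z) :
    dynFun (⟨(x, y), hp⟩, ⟨(z, w), hq⟩) = (⟨(a, b), ha⟩, ⟨(c, d), hc⟩) := by
  obtain ⟨hx, hy⟩ := hp
  obtain ⟨hz, hw⟩ := hq
  simp only [dynFun, Prod.mk.injEq, Subtype.mk.injEq]
  refine ⟨⟨h₁, ?_⟩, ?_, ?_⟩
  · rw [div_eq_iff (by positivity), h₂]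
  · rw [div_eq_iff (by positivity), h₃]
  · rw [← mul_left_inj' hz.ne', ← h₄]
    field_simp

theorem dynFun_braid (p q r : PosPair) :
    let a₁ := dynFun (p, q)
    let a₂ := dynFun (a₁.2, r)
    let a₃ := dynFun (a₁.1, a₂.1)
    let b₁ := dynFun (q, r)
    let b₂ := dynFun (p, b₁.1)
    let b₃ := dynFun (b₂.2, b₁.2)
    a₃.1 = b₂.1 ∧ a₃.2 = b₃.1 ∧ a₂.2 = b₃.2 := by
  obtain ⟨⟨x, y⟩, hx, hy⟩ := p
  obtain ⟨⟨z, w⟩, hz, hw⟩ := q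
  obtain ⟨⟨u, t⟩, hu, ht⟩ := r
  dsimp only at hx hy hz hw hu ht
  obtain ⟨E, hE⟩ : ∃ E, E = z * y + x * (1 + y) * (1 + w) := ⟨_, rfl⟩
  obtain ⟨F, hF⟩ : ∃ F, F = z + x * (1 + w) := ⟨_, rfl⟩
  obtain ⟨K, hK⟩ : ∃ K, K = u * E + x * z * w * (1 + y) * (1 + t) := ⟨_, rfl⟩
  obtain ⟨L, hL⟩ : ∃ L, L = u * F + x * z * w * (1 + t) := ⟨_, rfl⟩
  obtain ⟨E', hE'⟩ : ∃ E', E' = u * w + z * (1 + w) * (1 + t) := ⟨_, rfl⟩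
  obtain ⟨F', hF'⟩ : ∃ F', F' = u + z * (1 + t) := ⟨_, rfl⟩
  obtain ⟨Q, hQ⟩ : ∃ Q, Q = y * E' + x * (1 + y) * (1 + t) := ⟨_, rfl⟩
  obtain ⟨R, hR⟩ : ∃ R, R = E' + x * (1 + t) := ⟨_, rfl⟩
  have pE : 0 < E := by rw [hE]; positivity
  have pF : 0 < F := by rw [hF]; positivity
  have pK : 0 < K := by rw [hK]; positivity
  have pL : 0 < L := by rw [hL]; positivity
  have pE' : 0 < E' := by rw [hE']; positivity
  have pF' : 0 < F' := by rw [hF']; positivity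
  have pQ : 0 < Q := by rw [hQ]; positivity
  have pR : 0 < R := by rw [hR]; positivity
  have ha₁ : dynFun (⟨(x, y), hx, hy⟩, ⟨(z, w), hz, hw⟩) =
      (⟨(x * (1 + y) + y * z, z * y * w / E), by constructor <;> dsimp only <;> positivity⟩,
       ⟨(x * z * w / F, E / z), by constructor <;> dsimp only <;> positivity⟩) := by
    apply dynFun_eq
    · rfl
    · rw [← hE]; field_simp
    · rw [← hF]; field_simp
    · rw [← hE]; field_simp
  have ha₂ : dynFun (⟨(x * z * w / F, E / z), by constructor <;> dsimp only <;> positivity⟩,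
        ⟨(u, t), hu, ht⟩) =
      (⟨((x * z * w * (1 + y) + E * u) / z, u * E * t / K),
          by constructor <;> dsimp only <;> positivity⟩,
       ⟨(x * z * w * u * t / L, K / (z * u)),
          by constructor <;> dsimp only <;> positivity⟩) := by
    have e : z + E = (1 + y) * F := by rw [hE, hF]; ring
    have e₁ : 1 + E / z = (1 + y) * F / z := by rw [← e]; field_simp
    have e₂ : u * (E / z) + x * z * w / F * (1 + E / z) * (1 + t) = K / z := by
      rw [e₁, hK]; field_simp
    have e₃ : u + x * z * w / F * (1 + t) = L / F := by
      rw [hL]; field_simp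
    apply dynFun_eq
    · rw [e₁]; field_simp
    · rw [e₂]; field_simp
    · rw [e₃]; field_simp
    · rw [e₂]; field_simp
  have hb₁ : dynFun (⟨(z, w), hz, hw⟩, ⟨(u, t), hu, ht⟩) =
      (⟨(z * (1 + w) + w * u, u * w * t / E'), by constructor <;> dsimp only <;> positivity⟩,
       ⟨(z * u * t / F', E' / u), by constructor <;> dsimp only <;> positivity⟩) := by
    apply dynFun_eq
    · rfl
    · rw [← hE']; field_simp
    · rw [← hF']; field_simp
    · rw [← hE']; field_simp
  have hb₂ : dynFun (⟨(x, y), hx, hy⟩, ⟨(z * (1 + w) + w * u, u * w * t / E'),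
        by constructor <;> dsimp only <;> positivity⟩) =
      (⟨(x * (1 + y) + y * (z * (1 + w) + w * u), y * u * w * t / Q),
          by constructor <;> dsimp only <;> positivity⟩,
       ⟨(x * u * w * t / R, Q / E'), by constructor <;> dsimp only <;> positivity⟩) := by
    have e₁ : 1 + u * w * t / E' = (1 + t) * (z * (1 + w) + w * u) / E' := by
      rw [eq_div_iff pE'.ne', add_mul, div_mul_cancel₀ _ pE'.ne', hE']; ring
    have e₂ : (z * (1 + w) + w * u) * y + x * (1 + y) * (1 + u * w * t / E') =
        (z * (1 + w) + w * u) * Q / E' := by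
      rw [e₁, hQ]; field_simp
    have e₃ : (z * (1 + w) + w * u) + x * (1 + u * w * t / E') =
        (z * (1 + w) + w * u) * R / E' := by
      rw [e₁, hR]; field_simp
    apply dynFun_eq
    · rfl
    · rw [e₂]; field_simp
    · rw [e₃]; field_simp
    · rw [e₂]; field_simp
  obtain ⟨X, hX⟩ : ∃ X, X = x * (1 + y) + y * z := ⟨_, rfl⟩
  have pX : 0 < X := by rw [hX]; positivity
  obtain ⟨P, hP⟩ : ∃ P, P = x * z * w * (1 + y) + E * u := ⟨_, rfl⟩
  have pP : 0 < P := by rw [hP]; positivity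
  have ha₃ : dynFun (⟨(X, z * y * w / E), by constructor <;> dsimp only <;> positivity⟩,
        ⟨(P / z, u * E * t / K), by constructor <;> dsimp only <;> positivity⟩) =
      (⟨(x * (1 + y) + y * (z * (1 + w) + w * u), y * u * w * t / Q),
          by constructor <;> dsimp only <;> positivity⟩,
       ⟨(X * u * t / F', Q * z / K), by constructor <;> dsimp only <;> positivity⟩) := by
    have e₁ : 1 + z * y * w / E = (1 + w) * X / E := by
      rw [eq_div_iff pE.ne', add_mul, div_mul_cancel₀ _ pE.ne', hE, hX]; ring
    have e₂ : 1 + u * E * t / K = (1 + t) * P / K := by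
      rw [eq_div_iff pK.ne', add_mul, div_mul_cancel₀ _ pK.ne', hK, hP]; ring
    have e₃ : y * w * K + X ^ 2 * (1 + w) * (1 + t) = Q * E := by
      rw [hK, hX, hQ, hE', hE]; ring
    have e₄ : P / z * (z * y * w / E) + X * (1 + z * y * w / E) * (1 + u * E * t / K) =
        P * Q / K := by
      rw [e₁, e₂]
      field_simp
      linear_combination e₃
    have e₅ : K + z * X * (1 + t) = E * F' := by
      rw [hK, hX, hE, hF']; ring
    have e₆ : P / z + X * (1 + u * E * t / K) = P * E * F' / (z * K) := by
      rw [e₂]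
      field_simp
      linear_combination e₅
    apply dynFun_eq
    · rw [e₁]
      field_simp
      rw [hX, hP, hE]; ring
    · rw [e₄]; field_simp
    · rw [e₆]; field_simp
    · rw [e₄]; field_simp
  have hb₃ : dynFun (⟨(x * u * w * t / R, Q / E'), by constructor <;> dsimp only <;> positivity⟩,
        ⟨(z * u * t / F', E' / u), by constructor <;> dsimp only <;> positivity⟩) =
      (⟨(X * u * t / F', Q * z / K), by constructor <;> dsimp only <;> positivity⟩,
       ⟨(x * z * w * u * t / L, K / (z * u)),
          by constructor <;> dsimp only <;> positivity⟩) := by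
    have e₁ : 1 + Q / E' = (1 + y) * R / E' := by
      rw [eq_div_iff pE'.ne', add_mul, div_mul_cancel₀ _ pE'.ne', hQ, hR]; ring
    have e₂ : 1 + E' / u = (1 + w) * F' / u := by
      rw [eq_div_iff hu.ne', add_mul, div_mul_cancel₀ _ hu.ne', hE', hF']; ring
    have e₃ : z * u * Q + x * w * (1 + y) * (1 + w) * F' ^ 2 = K * E' := by
      rw [hQ, hF', hK, hE', hE]; ring
    have e₄ : z * u * t / F' * (Q / E') + x * u * w * t / R * (1 + Q / E') * (1 + E' / u) =
        t * K / F' := by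
      rw [e₁, e₂]
      field_simp
      linear_combination e₃
    have e₅ : z * u * R + x * w * (1 + w) * F' ^ 2 = L * E' := by
      rw [hR, hF', hL, hE', hF]; ring
    have e₆ : z * u * t / F' + x * u * w * t / R * (1 + E' / u) = t * L * E' / (F' * R) := by
      rw [e₂]
      field_simp
      linear_combination e₅
    have e₇ : x * w * (1 + y) * F' + Q * z = X * E' := by
      rw [hF', hQ, hX, hE']; ring
    apply dynFun_eq
    · rw [e₁]
      field_simp
      linear_combination e₇
    · rw [e₄]; field_simp
    · rw [e₆]; field_simp
    · rw [e₄]; field_simp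
  subst hX hP
  simp only [ha₁, ha₂, ha₃, hb₁, hb₂, hb₃, and_self]

theorem dynAt_braid (i : ℕ) :
    dynAt i * dynAt (i + 1) * dynAt i = dynAt (i + 1) * dynAt i * dynAt (i + 1) := by
  ext v l : 2
  obtain ⟨h₁, h₂, h₃⟩ := dynFun_braid (v i) (v (i + 1)) (v (i + 1 + 1))
  simp only [Equiv.Perm.mul_apply, dynAt_apply]
  have e : i + 1 + 1 ≠ i := by omega
  simp only [if_true, Nat.succ_ne_self, if_false, e, (Nat.succ_ne_self _).symm, e.symm]
  by_cases e₁ : l = i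
  · subst e₁; simpa [e.symm] using h₁
  by_cases e₂ : l = i + 1
  · subst e₂; simpa using h₂
  by_cases e₃ : l = i + 1 + 1
  · subst e₃; simpa [e] using h₃
  simp [e₁, e₂, e₃]

/-- The action of the braid group on vectors of Dynnikov coordinates. -/
noncomputable def dynHom (n : ℕ) : Braid n →* Equiv.Perm (ℕ → PosPair) :=
  PresentedGroup.toGroup (f := fun i : Fin n => dynAt i) (by
    rintro r ⟨i, j, ⟨hij, rfl⟩ | ⟨hij, rfl⟩⟩
    · simp only [map_mul, map_inv, FreeGroup.lift_apply_of, ← hij]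
      rw [mul_inv_eq_one, dynAt_braid]
    · simp only [map_mul, map_inv, FreeGroup.lift_apply_of]
      rw [mul_inv_eq_one, dynAt_comm hij])

theorem dynHom_gen {n i : ℕ} (hi : i < n) : dynHom n (gen n i) = dynAt i := by
  rw [gen, dif_pos hi]
  exact PresentedGroup.toGroup.of _

end Dynnikov

theorem dynHom_apply_zero_of_mem {n : ℕ} {g : Braid n} (hg : g ∈ G₁b n) (v : ℕ → PosPair) :
    dynHom n g v 0 = v 0 := by
  induction hg using Subgroup.closure_induction generalizing v with
  | mem x hx =>
    obtain ⟨i, hi, hin, rfl⟩ := hx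
    rw [dynHom_gen hin, dynAt_apply_zero hi]
  | one => simp
  | mul x y _ _ hx hy => rw [map_mul, Equiv.Perm.mul_apply, hx, hy]
  | inv x _ hx =>
    have := hx (dynHom n x⁻¹ v)
    rw [← Equiv.Perm.mul_apply, ← map_mul, mul_inv_cancel, map_one] at this
    exact this.symm

/-- Membership in `S1Neg` in terms of lists. -/
theorem mem_S1Neg_iff {n : ℕ} {β : Braid n} :
    β ∈ S1Neg n ↔ ∃ l : List (Braid n), l ≠ [] ∧ (∀ x ∈ l, x ∈ G₁b n) ∧
      ∃ b ∈ G₁b n, β = (l.map (fun x => x * (gen n 0)⁻¹)).prod * b := by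
  constructor
  · rintro ⟨m, hm, b, hb, rfl⟩
    refine ⟨List.ofFn fun i : Fin m => b i.castSucc, ?_, ?_, b (Fin.last m), hb _, ?_⟩
    · intro h
      have := congrArg List.length h
      simp at this
      omega
    · intro x hx
      obtain ⟨i, rfl⟩ := (List.mem_ofFn' _ _).mp hx
      exact hb _
    · rw [List.map_ofFn]
      rfl
  · rintro ⟨l, hl, hlG, b, hb, rfl⟩
    refine ⟨l.length, List.length_pos_iff.mpr hl, Fin.snoc (fun i => l.get i) b, ?_, ?_⟩
    · intro i
      refine Fin.lastCases ?_ (fun i => ?_) i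
      · simpa using hb
      · simpa using hlG _ (List.getElem_mem _)
    · simp only [Fin.snoc_castSucc, Fin.snoc_last]
      congr 2
      rw [← List.ofFn_get (l.map _)]
      apply List.ext_getElem <;> simp

theorem S1Neg_mul {n : ℕ} {β γ : Braid n} (hβ : β ∈ S1Neg n) (hγ : γ ∈ S1Neg n) :
    β * γ ∈ S1Neg n := by
  rw [mem_S1Neg_iff] at *
  obtain ⟨l, hl, hlG, b, hb, rfl⟩ := hβ
  obtain ⟨l', hl', hlG', b', hb', rfl⟩ := hγ
  obtain ⟨x, l', rfl⟩ := List.exists_cons_of_ne_nil hl'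
  refine ⟨l ++ (b * x) :: l', by simp, ?_, b', hb', by simp [mul_assoc]⟩
  simp only [List.mem_append, List.mem_cons] at *
  rintro y (hy | rfl | hy)
  · exact hlG y hy
  · exact mul_mem hb (hlG' _ (Or.inl rfl))
  · exact hlG' _ (Or.inr hy)

theorem mul_inv_mul_mem_S1Neg {n : ℕ} {g h : Braid n} (hg : g ∈ G₁b n) (hh : h ∈ G₁b n) :
    g * (gen n 0)⁻¹ * h ∈ S1Neg n :=
  mem_S1Neg_iff.mpr ⟨[g], by simp, by simpa using hg, h, hh, by simp⟩

/-- An `r₁`-negative braid strictly decreases the first Dynnikov coordinate. -/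
theorem dynHom_lt_of_mem_S1Neg {n : ℕ} (hn : 0 < n) {β : Braid n} (hβ : β ∈ S1Neg n)
    (v : ℕ → PosPair) : (dynHom n β v 0).1.1 < (v 0).1.1 := by
  obtain ⟨l, hl, hlG, b, hb, rfl⟩ := mem_S1Neg_iff.mp hβ
  have key : ∀ w : ℕ → PosPair, (dynHom n (gen n 0)⁻¹ w 0).1.1 < (w 0).1.1 := by
    intro w
    have := lt_dynAt_zero (dynHom n (gen n 0)⁻¹ w)
    rwa [← dynHom_gen hn, ← Equiv.Perm.mul_apply, ← map_mul, mul_inv_cancel, map_one] at this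
  have step : ∀ l : List (Braid n), (∀ x ∈ l, x ∈ G₁b n) → ∀ w : ℕ → PosPair,
      (dynHom n (l.map (fun x => x * (gen n 0)⁻¹)).prod w 0).1.1 ≤ (w 0).1.1 := by
    intro l
    induction l with
    | nil => simp
    | cons x l ih =>
      intro hx w
      rw [List.map_cons, List.prod_cons, map_mul, map_mul, Equiv.Perm.mul_apply,
        Equiv.Perm.mul_apply, dynHom_apply_zero_of_mem (hx x (by simp))]
      exact (key _).le.trans (ih (fun y hy => hx y (by simp [hy])) w)
  obtain ⟨x, l, rfl⟩ := List.exists_cons_of_ne_nil hl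
  rw [List.map_cons, List.prod_cons, map_mul, map_mul, map_mul, Equiv.Perm.mul_apply,
    Equiv.Perm.mul_apply, Equiv.Perm.mul_apply, dynHom_apply_zero_of_mem (hlG x (by simp))]
  refine (key _).trans_le ((step l (fun y hy => hlG y (by simp [hy])) _).trans ?_)
  rw [dynHom_apply_zero_of_mem hb]

theorem not_mem_S1Neg_of_mem {n : ℕ} (hn : 0 < n) {β : Braid n} (hβ : β ∈ G₁b n) :
    β ∉ S1Neg n := by
  intro h
  have := dynHom_lt_of_mem_S1Neg hn h (fun _ => ⟨(1, 1), by simp⟩)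
  rw [dynHom_apply_zero_of_mem hβ] at this
  exact lt_irrefl _ this

end BraidOrder

namespace BraidOrder

theorem gen_braid {n i : ℕ} (h : i + 1 < n) :
    gen n i * gen n (i + 1) * gen n i = gen n (i + 1) * gen n i * gen n (i + 1) := by
  have hi : i < n := by omega
  simp only [gen, dif_pos h, dif_pos hi]
  rw [← mul_inv_eq_one]
  exact PresentedGroup.one_of_mem (rels := braidRel n) ⟨⟨i, hi⟩, ⟨i + 1, h⟩, Or.inl ⟨rfl, rfl⟩⟩

theorem gen_commute {n i j : ℕ} (h : i + 2 ≤ j) : Commute (gen n i) (gen n j) := by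
  by_cases hj : j < n
  · have hi : i < n := by omega
    simp only [gen, dif_pos hj, dif_pos hi]
    rw [Commute, SemiconjBy, ← mul_inv_eq_one]
    exact PresentedGroup.one_of_mem (rels := braidRel n) ⟨⟨i, hi⟩, ⟨j, hj⟩, Or.inr ⟨h, rfl⟩⟩
  · simp [gen, hj]

/-- The subgroup generated by the `gen n i` with `a ≤ i < b`. -/
def genIco (n a b : ℕ) : Subgroup (Braid n) :=
  Subgroup.closure {x | ∃ i, a ≤ i ∧ i < b ∧ x = gen n i}

theorem gen_mem_genIco {n a b i : ℕ} (ha : a ≤ i) (hb : i < b) : gen n i ∈ genIco n a b :=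
  Subgroup.subset_closure ⟨i, ha, hb, rfl⟩

theorem genIco_mono {n a b a' b' : ℕ} (ha : a' ≤ a) (hb : b ≤ b') :
    genIco n a b ≤ genIco n a' b' := by
  apply Subgroup.closure_mono
  rintro x ⟨i, h1, h2, rfl⟩
  exact ⟨i, by omega, by omega, rfl⟩

theorem genIco_le_G₁b (n b : ℕ) : genIco n 1 b ≤ G₁b n := by
  rw [genIco, Subgroup.closure_le]
  rintro x ⟨i, h1, h2, rfl⟩
  by_cases hi : i < n
  · exact Subgroup.subset_closure ⟨i, h1, hi, rfl⟩
  · simp [gen, hi]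

theorem commute_of_mem_genIco {n a b c d : ℕ} (h : b + 1 ≤ c) {x y : Braid n}
    (hx : x ∈ genIco n a b) (hy : y ∈ genIco n c d) : Commute x y := by
  have h1 : genIco n a b ≤ Subgroup.centralizer (genIco n c d : Set (Braid n)) := by
    rw [genIco, genIco, Subgroup.centralizer_closure, Subgroup.closure_le]
    rintro _ ⟨i, hi1, hi2, rfl⟩
    rw [SetLike.mem_coe, Subgroup.mem_centralizer_iff]
    rintro _ ⟨j, hj1, hj2, rfl⟩
    exact (gen_commute (show i + 2 ≤ j by omega)).symm.eq
  exact (Subgroup.mem_centralizer_iff.1 (h1 hx) y hy).symm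

/-- The subgroup generated by the `gen n i` with `i < b` and `i % 2 = e`. -/
def genParity (n b e : ℕ) : Subgroup (Braid n) :=
  Subgroup.closure {x | ∃ i, i < b ∧ i % 2 = e ∧ x = gen n i}

theorem genParity_split {n b e m : ℕ} (hm : m % 2 ≠ e) {x : Braid n} (hx : x ∈ genParity n b e) :
    ∃ y ∈ genIco n (m + 1) b, ∃ z ∈ genIco n 0 m, x = y * z := by
  induction hx using Subgroup.closure_induction with
  | mem x hx =>
    obtain ⟨i, hi, he, rfl⟩ := hx
    rcases lt_or_ge i m with h | h
    · exact ⟨1, one_mem _, _, gen_mem_genIco (Nat.zero_le i) h, by simp⟩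
    · have : i ≠ m := by rintro rfl; exact hm he
      exact ⟨_, gen_mem_genIco (by omega) hi, 1, one_mem _, by simp⟩
  | one => exact ⟨1, one_mem _, 1, one_mem _, by simp⟩
  | mul x x' _ _ h h' =>
    obtain ⟨y, hy, z, hz, rfl⟩ := h
    obtain ⟨y', hy', z', hz', rfl⟩ := h'
    refine ⟨y * y', mul_mem hy hy', z * z', mul_mem hz hz', ?_⟩
    have := commute_of_mem_genIco le_rfl hz hy'
    rw [mul_assoc, ← mul_assoc z, this.eq]; group
  | inv x _ h =>
    obtain ⟨y, hy, z, hz, rfl⟩ := h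
    have := commute_of_mem_genIco le_rfl hz hy
    exact ⟨y⁻¹, inv_mem hy, z⁻¹, inv_mem hz, by rw [mul_inv_rev, this.inv_inv.eq]⟩

theorem genParity_mul {n b e m p q : ℕ} (hm : m % 2 ≠ e) (hmb : m + 1 ≤ b) (hp : m + 1 ≤ p)
    (hq : q ≤ m + 1) (hqp : q ≤ p) {x u : Braid n} (hx : x ∈ genParity n b e)
    (hu : ∃ y ∈ genIco n p b, ∃ z ∈ genIco n 0 (b - 1), u = y * z) :
    ∃ y ∈ genIco n q b, ∃ z ∈ genIco n 0 (b - 1), x * u = y * z := by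
  obtain ⟨y, hy, z, hz, rfl⟩ := genParity_split hm hx
  obtain ⟨y', hy', z', hz', rfl⟩ := hu
  refine ⟨y * y', mul_mem (genIco_mono hq le_rfl hy) (genIco_mono hqp le_rfl hy'), z * z',
    mul_mem (genIco_mono le_rfl (by omega) hz) hz', ?_⟩
  have := commute_of_mem_genIco (by omega) hz hy'
  rw [mul_assoc, ← mul_assoc z, this.eq]; group

/-- The product `gen m * gen (m + 1) * ⋯ * gen (m + l - 1)`. -/
def ascProd (n m l : ℕ) : Braid n := ((List.range' m l).map (gen n)).prod

theorem ascProd_succ (n m l : ℕ) : ascProd n m (l + 1) = gen n m * ascProd n (m + 1) l := by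
  simp [ascProd, List.range'_succ]

theorem ascProd_mem (n m l : ℕ) : ascProd n m l ∈ genIco n m (m + l) := by
  apply Subgroup.list_prod_mem
  intro x hx
  obtain ⟨i, hi, rfl⟩ := List.mem_map.1 hx
  rw [List.mem_range'_1] at hi
  exact gen_mem_genIco hi.1 hi.2

theorem ascProd_mul_gen {n m l i : ℕ} (hi : m ≤ i) (hil : i + 1 < m + l) (hn : m + l ≤ n) :
    ascProd n m l * gen n i = gen n (i + 1) * ascProd n m l := by
  induction l generalizing m with
  | zero => omega
  | succ l ih =>
    rw [ascProd_succ]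
    rcases hi.eq_or_lt with rfl | h
    · obtain ⟨l, rfl⟩ : ∃ l', l = l' + 1 := ⟨l - 1, by omega⟩
      have hc := commute_of_mem_genIco (le_refl (m + 2))
        (gen_mem_genIco le_rfl (Nat.lt_succ_self m)) (ascProd_mem n (m + 2) l)
      rw [ascProd_succ, mul_assoc, mul_assoc, ← hc.eq, ← mul_assoc, ← mul_assoc,
        gen_braid (by omega)]
      group
    · rw [mul_assoc, ih h (by omega) (by omega), ← mul_assoc,
        (gen_commute (n := n) (show m + 2 ≤ i + 1 by omega)).eq, mul_assoc]

theorem ascProd_conj_mem {n l : ℕ} (hn : l ≤ n) {x : Braid n} (hx : x ∈ genIco n 0 (l - 1)) :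
    ascProd n 0 l * x * (ascProd n 0 l)⁻¹ ∈ genIco n 1 l := by
  have : genIco n 0 (l - 1) ≤ (genIco n 1 l).comap (MulAut.conj (ascProd n 0 l)).toMonoidHom := by
    rw [genIco, Subgroup.closure_le]
    rintro _ ⟨i, -, hi, rfl⟩
    simp only [SetLike.mem_coe, Subgroup.mem_comap, MulEquiv.toMonoidHom_eq_coe, MonoidHom.coe_coe,
      MulAut.conj_apply]
    rw [ascProd_mul_gen (Nat.zero_le i) (by omega) (by omega), mul_inv_cancel_right]
    exact gen_mem_genIco (by omega) (by omega)
  exact this hx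

/-- The product `gen e * gen (e + 2) * ⋯` with `k` factors. -/
def stepProd (n e k : ℕ) : Braid n := (List.ofFn (fun j : Fin k => gen n (2 * (j : ℕ) + e))).prod

theorem stepProd_succ (n e k : ℕ) : stepProd n e (k + 1) = stepProd n e k * gen n (2 * k + e) := by
  simp only [stepProd, List.ofFn_succ', List.concat_eq_append, List.prod_append]
  simp

theorem stepProd_mem_genParity {n e k b : ℕ} (he : e < 2) (hb : 2 * k + e ≤ b + 1) :
    stepProd n e k ∈ genParity n b e := by
  apply Subgroup.list_prod_mem
  intro x hx
  obtain ⟨j, rfl⟩ := List.mem_ofFn.1 hx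
  exact Subgroup.subset_closure ⟨_, by omega, by omega, rfl⟩

theorem stepProd_mem_genIco (n e k : ℕ) : stepProd n e k ∈ genIco n 0 (2 * k + e - 1) := by
  apply Subgroup.list_prod_mem
  intro x hx
  obtain ⟨j, rfl⟩ := List.mem_ofFn.1 hx
  exact gen_mem_genIco (by omega) (by omega)

theorem stepProd_split {n e k j : ℕ} (hj : j < k) :
    ∃ y ∈ genIco n (2 * j + e + 2) (2 * k + e - 1), ∃ z ∈ genIco n 0 (2 * j + e - 1),
      stepProd n e k = y * gen n (2 * j + e) * z := by
  induction k with
  | zero => omega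
  | succ k ih =>
    rw [stepProd_succ]
    rcases (Nat.lt_succ_iff.1 hj).eq_or_lt with rfl | h
    · refine ⟨1, one_mem _, _, stepProd_mem_genIco n e j, ?_⟩
      by_cases h0 : 2 * j + e = 0
      · obtain ⟨rfl, rfl⟩ : j = 0 ∧ e = 0 := by omega
        simp [stepProd]
      · have := commute_of_mem_genIco (n := n) (b := 2 * j + e - 1) (by omega)
          (stepProd_mem_genIco n e j) (gen_mem_genIco le_rfl (Nat.lt_succ_self (2 * j + e)))
        rw [one_mul, this.eq]
    · obtain ⟨y, hy, z, hz, heq⟩ := ih h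
      refine ⟨y * gen n (2 * k + e), mul_mem (genIco_mono le_rfl (by omega) hy)
        (gen_mem_genIco (by omega) (by omega)), z, hz, ?_⟩
      have hg : gen n (2 * k + e) ∈ genIco n (2 * k + e) (2 * k + e + 1) :=
        gen_mem_genIco le_rfl (by omega)
      have h1 := commute_of_mem_genIco (by omega) hz hg
      have h2 := gen_commute (n := n) (show 2 * j + e + 2 ≤ 2 * k + e by omega)
      rw [heq, mul_assoc, h1.eq, ← mul_assoc, mul_assoc y, h2.eq]
      group

theorem stepProd_mul {n e k j l l' b m m' p p' : ℕ} (hj : j < k) (hb : 2 * k + e ≤ b + 1)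
    (hm : m = 2 * j + e) (hm' : m' = m + 1) (hl : m' + l = b) (hl' : l' = l + 1)
    (hp : p ≤ m + 2) (hp' : m + 3 ≤ p') {u : Braid n}
    (hu : ∃ y ∈ genIco n p' b, ∃ z ∈ genIco n 0 (b - 1), u = y * ascProd n m' l * z) :
    ∃ y ∈ genIco n p b, ∃ z ∈ genIco n 0 (b - 1),
      stepProd n e k * u = y * ascProd n m l' * z := by
  subst hm hm' hl'
  obtain ⟨y', hy', z', hz', rfl⟩ := hu
  obtain ⟨y, hy, z, hz, heq⟩ := stepProd_split (n := n) (e := e) hj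
  refine ⟨y * y', mul_mem (genIco_mono hp (by omega) hy) (genIco_mono (by omega) le_rfl hy'),
    z * z', mul_mem (genIco_mono le_rfl (by omega) hz) hz', ?_⟩
  have h1 := commute_of_mem_genIco (n := n) (by omega) hz hy'
  have h2 := commute_of_mem_genIco (n := n) (by omega) hz (ascProd_mem n (2 * j + e + 1) l)
  have h3 := commute_of_mem_genIco (n := n) (by omega)
    (gen_mem_genIco (a := 0) (by omega) (Nat.lt_succ_self (2 * j + e))) hy'
  rw [heq, ascProd_succ]
  calc y * gen n (2 * j + e) * z * (y' * ascProd n (2 * j + e + 1) l * z')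
      = y * gen n (2 * j + e) * (z * y') * ascProd n (2 * j + e + 1) l * z' := by group
    _ = y * (gen n (2 * j + e) * y') * (z * ascProd n (2 * j + e + 1) l) * z' := by
      rw [h1.eq]; group
    _ = _ := by rw [h3.eq, h2.eq]; group

end BraidOrder

namespace DihedralArtin

open BraidOrder

/-- Elements `t^{p₀} s^{q₁} t^{p₁} ⋯ s^{q_d} t^{p_d}` with arbitrary integer exponents. -/
def blockSet (m : ℕ) : ℕ → Set (DG m)
  | 0 => {x | ∃ a : ℤ, x = tA m ^ a}
  | d + 1 => {x | ∃ a b : ℤ, ∃ y ∈ blockSet m d, x = tA m ^ a * sA m ^ b * y}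

section Image

variable {k : ℕ} {ι : DG (2 * k) →* Braid (2 * k)}

theorem map_blockSet (hk : 2 ≤ k)
    (hs : ι (sA (2 * k)) = stepProd (2 * k) 0 k)
    (ht : ι (tA (2 * k)) = stepProd (2 * k) 1 (k - 1)) {d : ℕ} (hd : d + 1 ≤ k)
    {x : DG (2 * k)} (hx : x ∈ blockSet (2 * k) d) :
    ∃ y ∈ genIco (2 * k) (2 * k - 1 - 2 * d) (2 * k - 1),
      ∃ z ∈ genIco (2 * k) 0 (2 * k - 1 - 1), ι x = y * z := by
  induction d generalizing x with
  | zero =>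
    obtain ⟨a, rfl⟩ := hx
    refine ⟨1, one_mem _, _, zpow_mem (genIco_mono le_rfl ?_ (stepProd_mem_genIco _ 1 (k - 1))) a,
      by rw [map_zpow, ht, one_mul]⟩
    omega
  | succ d ih =>
    obtain ⟨a, b, y, hy, rfl⟩ := hx
    have h1 := genParity_mul (n := 2 * k) (b := 2 * k - 1) (e := 0) (m := 2 * k - 3 - 2 * d)
      (q := 2 * k - 2 - 2 * d) (by omega) (by omega) (by omega) (by omega) (by omega)
      (zpow_mem (stepProd_mem_genParity (k := k) (by omega) (by omega)) b) (ih (by omega) hy)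
    rw [map_mul, map_mul, map_zpow, map_zpow, hs, ht, mul_assoc]
    exact genParity_mul (e := 1) (m := 2 * k - 4 - 2 * d)
      (by omega) (by omega) (by omega) (by omega) (by omega)
      (zpow_mem (stepProd_mem_genParity (k := k - 1) (by omega) (by omega)) a) h1

theorem map_tA_mul_pow (hk : 2 ≤ k)
    (hs : ι (sA (2 * k)) = stepProd (2 * k) 0 k)
    (ht : ι (tA (2 * k)) = stepProd (2 * k) 1 (k - 1)) {d : ℕ} (hd : d + 1 ≤ k) :
    ∃ y ∈ genIco (2 * k) (2 * k + 1 - 2 * d) (2 * k - 1),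
      ∃ z ∈ genIco (2 * k) 0 (2 * k - 1 - 1),
        ι (tA (2 * k) * (sA (2 * k) * tA (2 * k)) ^ d) =
          y * ascProd (2 * k) (2 * k - 1 - 2 * d) (2 * d) * z := by
  induction d with
  | zero =>
    refine ⟨1, one_mem _, _, genIco_mono le_rfl ?_ (stepProd_mem_genIco _ 1 (k - 1)),
      by simp [ht, ascProd]⟩
    omega
  | succ d ih =>
    have h1 := stepProd_mul (n := 2 * k) (b := 2 * k - 1) (e := 0) (k := k) (j := k - 1 - d)
      (m := 2 * k - 2 - 2 * d) (l' := 2 * d + 1) (p := 2 * k - 2 * d) (by omega) (by omega)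
      (by omega) (by omega) (by omega) (by omega) (by omega) (by omega) (ih (by omega))
    have h2 := stepProd_mul (n := 2 * k) (b := 2 * k - 1) (e := 1) (k := k - 1) (j := k - 2 - d)
      (m := 2 * k - 1 - 2 * (d + 1)) (l' := 2 * (d + 1)) (p := 2 * k + 1 - 2 * (d + 1))
      (by omega) (by omega) (by omega) (by omega) (by omega) (by omega) (by omega) (by omega) h1
    rwa [← hs, ← ht, ← map_mul, ← map_mul, show tA (2 * k) * (sA (2 * k) *
      (tA (2 * k) * (sA (2 * k) * tA (2 * k)) ^ d)) =
        tA (2 * k) * (sA (2 * k) * tA (2 * k)) ^ (d + 1) by rw [pow_succ']; group] at h2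

theorem map_pow_sA_mul_tA (hk : 2 ≤ k)
    (hs : ι (sA (2 * k)) = stepProd (2 * k) 0 k)
    (ht : ι (tA (2 * k)) = stepProd (2 * k) 1 (k - 1)) :
    ∃ y ∈ genIco (2 * k) 1 (2 * k - 1), ∃ z ∈ genIco (2 * k) 0 (2 * k - 1 - 1),
      ι ((sA (2 * k) * tA (2 * k)) ^ k) = y * ascProd (2 * k) 0 (2 * k - 1) * z := by
  have h := stepProd_mul (n := 2 * k) (b := 2 * k - 1) (e := 0) (k := k) (j := 0) (m := 0)
    (l' := 2 * k - 1) (p := 1) (by omega) (by omega) (by omega) (by omega) (by omega) (by omega)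
    (by omega) (by omega) (map_tA_mul_pow hk hs ht (d := k - 1) (by omega))
  rwa [← hs, ← map_mul, ← mul_assoc, ← pow_succ', Nat.sub_add_cancel (by omega)] at h

theorem map_mul_inv_mem_S1Neg (hk : 2 ≤ k)
    (hs : ι (sA (2 * k)) = stepProd (2 * k) 0 k)
    (ht : ι (tA (2 * k)) = stepProd (2 * k) 1 (k - 1))
    {x : DG (2 * k)} (hx : x ∈ blockSet (2 * k) (k - 1)) :
    ι (x * ((sA (2 * k) * tA (2 * k)) ^ k)⁻¹) ∈ S1Neg (2 * k) := by
  obtain ⟨y, hy, z, hz, hxe⟩ := map_blockSet hk hs ht (by omega) hx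
  obtain ⟨y', hy', z', hz', hd⟩ := map_pow_sA_mul_tA hk hs ht
  rw [show 2 * k - 1 - 2 * (k - 1) = 1 by omega] at hy
  have hc := ascProd_conj_mem (n := 2 * k) (l := 2 * k - 1) (by omega) (mul_mem hz (inv_mem hz'))
  have ha : ascProd (2 * k) 0 (2 * k - 1) = gen (2 * k) 0 * ascProd (2 * k) 1 (2 * k - 2) := by
    rw [← ascProd_succ]; congr 1; omega
  have hr : ascProd (2 * k) 1 (2 * k - 2) ∈ genIco (2 * k) 1 (2 * k - 1) :=
    genIco_mono le_rfl (by omega) (ascProd_mem (2 * k) 1 (2 * k - 2))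
  have := mul_inv_mul_mem_S1Neg (genIco_le_G₁b _ _ (mul_mem hy (inv_mem hr)))
    (genIco_le_G₁b _ _ (mul_mem hc (inv_mem hy')))
  convert this using 1
  rw [map_mul, map_inv, hxe, hd, ha]
  group

end Image

end DihedralArtin

namespace DihedralArtin

theorem mul_tA_zpow_mem_blockSet {m d : ℕ} {x : DG m} (hx : x ∈ blockSet m d) (z : ℤ) :
    x * tA m ^ z ∈ blockSet m d := by
  induction d generalizing x with
  | zero => obtain ⟨a, rfl⟩ := hx; exact ⟨a + z, (zpow_add _ _ _).symm⟩
  | succ d ih => obtain ⟨a, b, y, hy, rfl⟩ := hx; exact ⟨a, b, _, ih hy, by group⟩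

theorem mul_sA_zpow_mem_blockSet {m d : ℕ} {x : DG m} (hx : x ∈ blockSet m d) (z : ℤ) :
    x * sA m ^ z ∈ blockSet m (d + 1) := by
  induction d generalizing x with
  | zero => obtain ⟨a, rfl⟩ := hx; exact ⟨a, z, 1, ⟨0, by simp⟩, by simp⟩
  | succ d ih => obtain ⟨a, b, y, hy, rfl⟩ := hx; exact ⟨a, b, _, ih hy, by group⟩

theorem blockSet_subset_succ (m d : ℕ) : blockSet m d ⊆ blockSet m (d + 1) := fun x hx =>
  ⟨0, 0, x, hx, by simp⟩

theorem blockSet_mono (m : ℕ) : Monotone (blockSet m) :=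
  monotone_nat_of_le_succ (blockSet_subset_succ m)

theorem exists_mul_of_mem_blockSet_add {m d e : ℕ} {x : DG m} (hx : x ∈ blockSet m (d + e)) :
    ∃ y ∈ blockSet m d, ∃ z ∈ blockSet m e, x = y * z := by
  induction d generalizing x with
  | zero => exact ⟨1, ⟨0, by simp⟩, x, by simpa using hx, by simp⟩
  | succ d ih =>
    rw [Nat.succ_add] at hx
    obtain ⟨a, b, w, hw, rfl⟩ := hx
    obtain ⟨y, hy, z, hz, rfl⟩ := ih hw
    exact ⟨_, ⟨a, b, y, hy, rfl⟩, z, hz, by group⟩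

/-- The generator `s` or `t`, indexed by the corresponding letter. -/
def letter (m : ℕ) (b : Bool) : DG m := PresentedGroup.of b

@[simp] theorem letter_true (m : ℕ) : letter m true = sA m := rfl

@[simp] theorem letter_false (m : ℕ) : letter m false = tA m := rfl

/-- The alternating product of length `l` whose last letter is `b`. -/
def altr (m : ℕ) : Bool → ℕ → DG m
  | _, 0 => 1
  | b, l + 1 => altr m (!b) l * letter m b

/-- The first letter of the alternating word of length `l` ending in `b`
(and the opposite of `b` when `l = 0`). -/
def firstLetter : Bool → ℕ → Bool
  | b, 0 => !b
  | b, l + 1 => firstLetter (!b) l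

/-- The number of letters `s` in the alternating word of length `l` ending in `b`. -/
def count : Bool → ℕ → ℕ
  | _, 0 => 0
  | b, l + 1 => count (!b) l + b.toNat

/-- The number of letters `s`, not counting the first letter, in the alternating word of
length `l` ending in `b`. -/
def inc : Bool → ℕ → ℕ
  | _, 0 => 0
  | _, 1 => 0
  | b, l + 2 => inc (!b) (l + 1) + b.toNat

theorem inc_add {b : Bool} {l : ℕ} (hl : 1 ≤ l) :
    inc b l + (firstLetter b l).toNat = count b l := by
  induction l generalizing b with
  | zero => omega
  | succ l ih =>
    cases l with
    | zero => simp [inc, firstLetter, count]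
    | succ l =>
      have := ih (b := !b) (by omega)
      rw [inc, count, firstLetter]; omega

theorem count_add (b : Bool) (p q : ℕ) :
    count b (p + q) = count (!firstLetter b q) p + count b q := by
  induction q generalizing b with
  | zero => simp [firstLetter, count]
  | succ q ih => rw [← add_assoc, count, ih, firstLetter, count, add_assoc]

theorem count_two_mul (b : Bool) (k : ℕ) : count b (2 * k) = k := by
  induction k with
  | zero => rfl
  | succ k ih => rw [Nat.mul_succ, count, count, Bool.not_not, ih]; cases b <;> rfl

theorem altr_add (m : ℕ) (b : Bool) (p q : ℕ) :
    altr m b (p + q) = altr m (!firstLetter b q) p * altr m b q := by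
  induction q generalizing b with
  | zero => simp [firstLetter, altr]
  | succ q ih => rw [← add_assoc, altr, ih, firstLetter, altr, mul_assoc]

theorem firstLetter_eq (b : Bool) (l : ℕ) : firstLetter b l = (b ^^ decide (l % 2 = 0)) := by
  induction l generalizing b with
  | zero => simp [firstLetter]
  | succ l ih =>
    rw [firstLetter, ih]
    rcases Nat.mod_two_eq_zero_or_one l with h | h <;> simp [h, Nat.add_mod]

theorem firstLetter_compl {k l : ℕ} (b : Bool) (hl : l ≤ 2 * k) :
    firstLetter (!firstLetter b l) (2 * k - l) = !b := by
  rw [firstLetter_eq, firstLetter_eq]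
  have : (2 * k - l) % 2 = l % 2 := by omega
  rw [this]
  rcases Nat.mod_two_eq_zero_or_one l with h | h <;> simp [h]

theorem altr_two_mul (m : ℕ) (b : Bool) (j : ℕ) :
    altr m b (2 * j) = (letter m (!b) * letter m b) ^ j := by
  induction j with
  | zero => rfl
  | succ j ih => rw [Nat.mul_succ, altr, altr, Bool.not_not, ih, pow_succ, mul_assoc]

theorem alt_two_mul {A : Type*} [Monoid A] (x y : A) (j : ℕ) : alt x y (2 * j) = (x * y) ^ j := by
  induction j with
  | zero => simp [alt]
  | succ j ih => rw [Nat.mul_succ, alt, alt, ih, pow_succ', mul_assoc]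

theorem map_alt {A B : Type*} [Monoid A] [Monoid B] (f : A →* B) (x y : A) (j : ℕ) :
    f (alt x y j) = alt (f x) (f y) j := by
  induction j generalizing x y with
  | zero => exact map_one f
  | succ j ih => rw [alt, map_mul, ih, alt]

theorem alt_sA_tA (m : ℕ) : alt (sA m) (tA m) m = alt (tA m) (sA m) m := by
  have h := PresentedGroup.one_of_mem (rels := dihedralRel m) (Set.mem_singleton _)
  rw [map_mul, map_inv, mul_inv_eq_one, map_alt, map_alt] at h
  exact h

variable {k : ℕ}

theorem Ωd_eq : Ωd (2 * k) = (sA (2 * k) * tA (2 * k)) ^ k := alt_two_mul _ _ _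

theorem altr_full (b : Bool) : altr (2 * k) b (2 * k) = Ωd (2 * k) := by
  have h := alt_sA_tA (2 * k)
  rw [altr_two_mul]
  rw [alt_two_mul, alt_two_mul] at h
  cases b
  · exact Ωd_eq.symm
  · exact h.symm.trans Ωd_eq.symm

theorem letter_commute_Ωd (b : Bool) : Commute (letter (2 * k) b) (Ωd (2 * k)) := by
  have h (j : ℕ) : letter (2 * k) b * (letter (2 * k) (!b) * letter (2 * k) b) ^ j =
      (letter (2 * k) b * letter (2 * k) (!b)) ^ j * letter (2 * k) b := by
    induction j with
    | zero => simp
    | succ j ih => rw [pow_succ, ← mul_assoc, ih, pow_succ]; group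
  have h1 := altr_full (k := k) b
  have h2 := altr_full (k := k) (!b)
  rw [altr_two_mul] at h1 h2
  rw [Bool.not_not] at h2
  have := h k
  rw [h1, h2] at this
  exact this

theorem commute_Ωd (x : DG (2 * k)) : Commute x (Ωd (2 * k)) := by
  have : Subgroup.closure (Set.range (PresentedGroup.of (rels := dihedralRel (2 * k)))) ≤
      Subgroup.centralizer {Ωd (2 * k)} := by
    rw [Subgroup.closure_le]
    rintro _ ⟨b, rfl⟩
    exact Subgroup.mem_centralizer_singleton_iff.2 (letter_commute_Ωd b)
  rw [PresentedGroup.closure_range_of] at this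
  exact Subgroup.mem_centralizer_singleton_iff.1 (this (Subgroup.mem_top x))

/-- The length homomorphism, sending each generator to `1`. -/
def len (m : ℕ) : DG m →* Multiplicative ℤ :=
  PresentedGroup.toGroup (f := fun _ => Multiplicative.ofAdd 1) (by
    rintro _ rfl
    rw [map_mul, map_inv, map_alt, map_alt]
    simp)

theorem len_letter (m : ℕ) (b : Bool) : (len m (letter m b)).toAdd = 1 := by
  simp [len, letter]

theorem len_altr (m : ℕ) (b : Bool) (l : ℕ) : (len m (altr m b l)).toAdd = l := by
  induction l generalizing b with
  | zero => simp [altr]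
  | succ l ih => simp [altr, ih, len_letter]

theorem len_Ωd : (len (2 * k) (Ωd (2 * k))).toAdd = 2 * k := by
  rw [← altr_full true, len_altr]; simp

/-- The product of alternating runs with lengths `ls` (last run first), the last letter being
`b`, and any two consecutive runs meeting in equal letters. -/
def runProd (m : ℕ) : Bool → List ℕ → DG m
  | _, [] => 1
  | b, l :: ls => runProd m (firstLetter b l) ls * altr m b l

/-- The letter that continues a run decomposition on the left. -/
def runFirst : Bool → List ℕ → Bool
  | b, [] => b
  | b, l :: ls => runFirst (firstLetter b l) ls

/-- The number of powers of `s` in a run decomposition, written with blocks of equal letters. -/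
def blocks : Bool → List ℕ → ℕ
  | b, [] => b.toNat
  | b, l :: ls => inc b l + blocks (firstLetter b l) ls

/-- Admissible run lengths. -/
def RunsValid (k : ℕ) (ls : List ℕ) : Prop := ∀ l ∈ ls, 1 ≤ l ∧ l < 2 * k

theorem RunsValid.nil : RunsValid k [] := by simp [RunsValid]

theorem runsValid_cons {l : ℕ} {ls : List ℕ} :
    RunsValid k (l :: ls) ↔ (1 ≤ l ∧ l < 2 * k) ∧ RunsValid k ls := by
  simp [RunsValid]

theorem runsValid_append {ls ls' : List ℕ} :
    RunsValid k (ls ++ ls') ↔ RunsValid k ls ∧ RunsValid k ls' := by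
  simp only [RunsValid, List.mem_append]
  grind

theorem RunsValid.sum_pos {ls : List ℕ} (h : RunsValid k ls) (hne : ls ≠ []) : 1 ≤ ls.sum := by
  cases ls with
  | nil => exact absurd rfl hne
  | cons l ls => have := (runsValid_cons.1 h).1; rw [List.sum_cons]; omega

theorem runProd_append (m : ℕ) (b : Bool) (ls ls' : List ℕ) :
    runProd m b (ls ++ ls') = runProd m (runFirst b ls) ls' * runProd m b ls := by
  induction ls generalizing b with
  | nil => simp [runProd, runFirst]
  | cons l ls ih => rw [List.cons_append, runProd, ih, runFirst, runProd, mul_assoc]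

theorem runFirst_append (b : Bool) (ls ls' : List ℕ) :
    runFirst b (ls ++ ls') = runFirst (runFirst b ls) ls' := by
  induction ls generalizing b with
  | nil => rfl
  | cons l ls ih => exact ih _

theorem blocks_append (b : Bool) (ls ls' : List ℕ) :
    blocks b (ls ++ ls') + (runFirst b ls).toNat = blocks b ls + blocks (runFirst b ls) ls' := by
  induction ls generalizing b with
  | nil => simp [blocks, runFirst, add_comm]
  | cons l ls ih =>
    rw [List.cons_append, blocks, blocks, runFirst, add_assoc, ih, add_assoc]

theorem len_runProd (m : ℕ) (b : Bool) (ls : List ℕ) :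
    (len m (runProd m b ls)).toAdd = ls.sum := by
  induction ls generalizing b with
  | nil => simp [runProd]
  | cons l ls ih => simp [runProd, ih, len_altr, add_comm]

theorem mul_letter_zpow_mem_blockSet {m d : ℕ} {x : DG m} (hx : x ∈ blockSet m d) (b : Bool)
    (z : ℤ) : x * letter m b ^ z ∈ blockSet m (d + b.toNat) := by
  cases b
  · exact mul_tA_zpow_mem_blockSet hx z
  · exact mul_sA_zpow_mem_blockSet hx z

theorem mul_altr_zpow_mem_blockSet {m d l : ℕ} {b : Bool} {x : DG m} (hl : 1 ≤ l)
    (hx : ∀ z : ℤ, x * letter m (firstLetter b l) ^ z ∈ blockSet m d) (z : ℤ) :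
    x * altr m b l * letter m b ^ z ∈ blockSet m (inc b l + d) := by
  induction l generalizing b z with
  | zero => omega
  | succ l ih =>
    have hz : letter m b * letter m b ^ z = letter m b ^ (1 + z) := by rw [zpow_one_add]
    cases l with
    | zero =>
      simp only [altr, one_mul, mul_assoc, hz, inc, zero_add]
      simpa [firstLetter] using hx (1 + z)
    | succ l =>
      have h := mul_letter_zpow_mem_blockSet (ih (b := !b) (by omega) hx 0) b (1 + z)
      rw [zpow_zero, mul_one] at h
      rw [altr, ← mul_assoc, mul_assoc _ (letter m b), hz, inc, add_right_comm]
      exact h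

theorem runProd_mul_zpow_mem_blockSet {m : ℕ} {b : Bool} {ls : List ℕ} (h : ∀ l ∈ ls, 1 ≤ l)
    (z : ℤ) : runProd m b ls * letter m b ^ z ∈ blockSet m (blocks b ls) := by
  induction ls generalizing b z with
  | nil => simpa [runProd, blocks] using mul_letter_zpow_mem_blockSet (m := m) (d := 0) ⟨0, rfl⟩ b z
  | cons l ls ih =>
    exact mul_altr_zpow_mem_blockSet (h l (by simp))
      (fun z => ih (fun l hl => h l (by simp [hl])) z) z

theorem runProd_mem_blockSet {m : ℕ} {b : Bool} {ls : List ℕ} (h : RunsValid k ls) :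
    runProd m b ls ∈ blockSet m (blocks b ls) := by
  simpa using runProd_mul_zpow_mem_blockSet (m := m) (b := b) (fun l hl => (h l hl).1) 0

theorem exists_complement (b : Bool) {ls : List ℕ} (h : RunsValid k ls) :
    ∃ b' ls', RunsValid k ls' ∧ ls'.length = ls.length ∧ runFirst b' ls' = !b ∧
      blocks b ls + blocks b' ls' = (k - 1) * ls.length + 1 ∧
      runProd (2 * k) b ls * runProd (2 * k) b' ls' = Ωd (2 * k) ^ ls.length := by
  induction ls generalizing b with
  | nil => exact ⟨!b, [], .nil, rfl, rfl, by cases b <;> rfl, by simp [runProd]⟩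
  | cons l ls ih =>
    obtain ⟨hl, hls⟩ := runsValid_cons.1 h
    obtain ⟨b', ls', hv, hlen, hf, hD, hp⟩ := ih (firstLetter b l) hls
    refine ⟨b', ls' ++ [2 * k - l], runsValid_append.2 ⟨hv, runsValid_cons.2 ⟨by omega, .nil⟩⟩,
      by simp [hlen], ?_, ?_, ?_⟩
    · rw [runFirst_append, hf]
      exact firstLetter_compl b (by omega)
    · have h1 := blocks_append b' ls' [2 * k - l]
      have h2 := inc_add (b := b) hl.1
      have h3 := inc_add (b := !firstLetter b l) (l := 2 * k - l) (by omega)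
      have h4 := count_add (!firstLetter b l) l (2 * k - l)
      rw [firstLetter_compl b (by omega), Bool.not_not, Nat.add_sub_cancel' (by omega),
        count_two_mul] at h4
      rw [hf] at h1
      simp only [blocks] at h1
      rw [firstLetter_compl b (by omega)] at h1 h3
      simp only [blocks, List.length_cons, Nat.mul_succ]
      have h5 : b.toNat + (!b).toNat = 1 := by cases b <;> rfl
      have h6 : (firstLetter b l).toNat + (!firstLetter b l).toNat = 1 := by
        cases firstLetter b l <;> rfl
      omega
    · rw [runProd_append, hf]
      simp only [runProd, one_mul]
      have h1 := altr_add (2 * k) (!firstLetter b l) l (2 * k - l)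
      rw [firstLetter_compl b (by omega), Bool.not_not, Nat.add_sub_cancel' (by omega),
        altr_full] at h1
      rw [mul_assoc, ← mul_assoc (altr _ _ _), ← h1, ← (commute_Ωd _).eq, ← mul_assoc, hp,
        List.length_cons, pow_succ]

theorem exists_runProd_mul_letter {b : Bool} {ls : List ℕ} (hk : 2 ≤ k) (h : RunsValid k ls)
    (c : Bool) : ∃ b' ls', RunsValid k ls' ∧
      ((runProd (2 * k) b ls * letter (2 * k) c = runProd (2 * k) b' ls' ∧ ls' ≠ [] ∧ b' = c) ∨
        runProd (2 * k) b ls * letter (2 * k) c = runProd (2 * k) b' ls' * Ωd (2 * k)) := by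
  cases ls with
  | nil =>
    exact ⟨c, [1], runsValid_cons.2 ⟨by omega, .nil⟩, Or.inl ⟨by simp [runProd, altr], by simp⟩⟩
  | cons l ls =>
    obtain ⟨hl, hls⟩ := runsValid_cons.1 h
    by_cases hbc : b = c
    · subst hbc
      exact ⟨b, 1 :: l :: ls, runsValid_cons.2 ⟨by omega, h⟩,
        Or.inl ⟨by simp [runProd, altr, firstLetter], by simp⟩⟩
    · obtain rfl : b = !c := by cases b <;> cases c <;> simp_all
      have h1 : runProd (2 * k) (!c) (l :: ls) * letter (2 * k) c =
          runProd (2 * k) (firstLetter (!c) l) ls * altr (2 * k) c (l + 1) := by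
        rw [runProd, altr, mul_assoc]
      by_cases hl' : l + 1 = 2 * k
      · rw [hl', altr_full] at h1
        exact ⟨_, ls, hls, Or.inr h1⟩
      · exact ⟨c, (l + 1) :: ls, runsValid_cons.2 ⟨by omega, hls⟩, Or.inl ⟨h1, by simp⟩⟩

theorem letter_mem (m : ℕ) (b : Bool) : letter m b ∈ Md m := by
  cases b
  · exact Submonoid.subset_closure (by simp)
  · exact Submonoid.subset_closure (by simp)

theorem altr_mem (m : ℕ) (b : Bool) (l : ℕ) : altr m b l ∈ Md m := by
  induction l generalizing b with
  | zero => exact one_mem _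
  | succ l ih => exact mul_mem (ih _) (letter_mem m b)

theorem Ωd_mem : Ωd (2 * k) ∈ Md (2 * k) := altr_full (k := k) true ▸ altr_mem _ _ _

theorem runProd_mem (m : ℕ) (b : Bool) (ls : List ℕ) : runProd m b ls ∈ Md m := by
  induction ls generalizing b with
  | nil => exact one_mem _
  | cons l ls ih => exact mul_mem (ih _) (altr_mem m b l)

theorem exists_runProd_mul {b : Bool} {ls : List ℕ} (hk : 2 ≤ k) (h : RunsValid k ls)
    {x : DG (2 * k)} (hx : x ∈ Md (2 * k)) : ∃ b' ls' i, RunsValid k ls' ∧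
      runProd (2 * k) b ls * x = runProd (2 * k) b' ls' * Ωd (2 * k) ^ (i : ℕ) := by
  induction hx using Submonoid.closure_induction_right with
  | one => exact ⟨b, ls, 0, h, by simp⟩
  | mul_right x hx y hy ih =>
    obtain ⟨c, rfl⟩ : ∃ c, y = letter (2 * k) c := by
      rcases hy with rfl | rfl
      exacts [⟨true, rfl⟩, ⟨false, rfl⟩]
    obtain ⟨b', ls', i, hv, he⟩ := ih
    obtain ⟨b'', ls'', hv', ⟨he', -⟩ | he'⟩ := exists_runProd_mul_letter (b := b') hk hv c
    · refine ⟨b'', ls'', i, hv', ?_⟩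
      rw [← mul_assoc, he, mul_assoc, ← ((commute_Ωd _).pow_right i).eq, ← mul_assoc, he']
    · refine ⟨b'', ls'', i + 1, hv', ?_⟩
      rw [← mul_assoc, he, mul_assoc, ← ((commute_Ωd _).pow_right i).eq, ← mul_assoc, he',
        mul_assoc, pow_succ']

theorem exists_runProd_of_mem (hk : 2 ≤ k) {x : DG (2 * k)} (hx : x ∈ Md (2 * k)) :
    ∃ b ls i, RunsValid k ls ∧ x = runProd (2 * k) b ls * Ωd (2 * k) ^ (i : ℕ) := by
  simpa [runProd] using exists_runProd_mul (b := true) hk .nil hx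

theorem exists_runProd (hk : 2 ≤ k) (x : DG (2 * k)) :
    ∃ b ls, ∃ j : ℤ, RunsValid k ls ∧ x = runProd (2 * k) b ls * (Ωd (2 * k) ^ j)⁻¹ := by
  have hc (z : ℤ) (y : DG (2 * k)) : y * (Ωd (2 * k) ^ z)⁻¹ = (Ωd (2 * k) ^ z)⁻¹ * y :=
    ((commute_Ωd y).zpow_right z).inv_right.eq
  have step (b ls) (j : ℤ) (h : RunsValid k ls) (y : DG (2 * k)) (hy : y ∈ Md (2 * k)) :
      ∃ b' ls', ∃ j' : ℤ, RunsValid k ls' ∧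
        runProd (2 * k) b ls * (Ωd (2 * k) ^ j)⁻¹ * y =
          runProd (2 * k) b' ls' * (Ωd (2 * k) ^ j')⁻¹ := by
    obtain ⟨b', ls', i, hv, he⟩ := exists_runProd_mul (b := b) hk h hy
    refine ⟨b', ls', j - i, hv, ?_⟩
    rw [mul_assoc, ← hc, ← mul_assoc, he]
    group
  have hx : x ∈ Subgroup.closure (Set.range (PresentedGroup.of (rels := dihedralRel (2 * k)))) := by
    rw [PresentedGroup.closure_range_of]; trivial
  induction hx using Subgroup.closure_induction_right with
  | one => exact ⟨true, [], 0, .nil, by simp [runProd]⟩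
  | mul_right x hx y hy ih =>
    obtain ⟨c, rfl⟩ := hy
    obtain ⟨b, ls, j, h, rfl⟩ := ih
    exact step b ls j h _ (letter_mem _ c)
  | mul_inv_cancel x hx y hy ih =>
    obtain ⟨c, rfl⟩ := hy
    obtain ⟨b, ls, j, h, rfl⟩ := ih
    have h1 : altr (2 * k) (!c) (2 * k - 1) * letter (2 * k) c = Ωd (2 * k) := by
      rw [← altr_full c, ← altr]; congr 1; omega
    obtain ⟨b', ls', j', h', he⟩ := step b ls (j + 1) h _ (altr_mem (2 * k) (!c) (2 * k - 1))
    refine ⟨b', ls', j', h', ?_⟩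
    rw [← he, show (PresentedGroup.of c : DG (2 * k)) = letter (2 * k) c from rfl,
      mul_inv_eq_iff_eq_mul, mul_assoc _ (altr _ _ _), h1, zpow_add_one]
    group

end DihedralArtin

namespace DihedralArtin

open GarsideOrder

variable {k : ℕ}

/-- No positive power `Ω^j` is a product of at most `(k - 1) j` powers of `s` and of powers
of `t`. -/
def PowNotMemBlocks (k : ℕ) : Prop :=
  ∀ j : ℕ, 1 ≤ j → Ωd (2 * k) ^ j ∉ blockSet (2 * k) ((k - 1) * j)

theorem PowNotMemBlocks.lt_blocks (hΔ : PowNotMemBlocks k) {b : Bool} {ls : List ℕ}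
    (h : RunsValid k ls) {q : ℕ} (hq : 1 ≤ q) (he : runProd (2 * k) b ls = Ωd (2 * k) ^ q) :
    (k - 1) * q < blocks b ls := by
  by_contra hlt
  exact hΔ q hq (he ▸ blockSet_mono _ (not_lt.1 hlt) (runProd_mem_blockSet h))

theorem exists_nat_of_runProd_eq_zpow (hk : 2 ≤ k) {b : Bool} {ls : List ℕ}
    (h : RunsValid k ls) (hne : ls ≠ []) {q : ℤ}
    (he : runProd (2 * k) b ls = Ωd (2 * k) ^ q) : ∃ p : ℕ, 1 ≤ p ∧ q = p := by
  have h1 := congrArg (fun x => (len (2 * k) x).toAdd) he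
  simp only [len_runProd, map_zpow, toAdd_zpow, len_Ωd, smul_eq_mul] at h1
  have h2 := h.sum_pos hne
  have hq : 0 < q := by
    by_contra hq
    have : q * (2 * k) ≤ 0 := mul_nonpos_of_nonpos_of_nonneg (not_lt.1 hq) (by positivity)
    omega
  exact ⟨q.toNat, by omega, by omega⟩

theorem runProd_ne_zpow (hΔ : PowNotMemBlocks k) (hk : 2 ≤ k) {b : Bool} {ls : List ℕ}
    (h : RunsValid k ls) (hne : ls ≠ []) (q : ℤ) :
    runProd (2 * k) b ls ≠ Ωd (2 * k) ^ q := by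
  intro he
  obtain ⟨b', ls', h', hlen, -, hD, hp⟩ := exists_complement b h
  obtain ⟨q, hq, rfl⟩ := exists_nat_of_runProd_eq_zpow hk h hne he
  have he' : runProd (2 * k) b' ls' = Ωd (2 * k) ^ ((ls.length : ℤ) - q) := by
    rw [zpow_sub, ← he, zpow_natCast, ← hp, he, zpow_natCast,
      ← ((commute_Ωd (runProd (2 * k) b' ls')).pow_right q).eq, mul_inv_cancel_right]
  obtain ⟨r, hr, hr'⟩ := exists_nat_of_runProd_eq_zpow hk h'
    (by rw [← List.length_pos_iff] at hne ⊢; omega) he'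
  rw [hr', zpow_natCast] at he'
  rw [zpow_natCast] at he
  have h1 := hΔ.lt_blocks h hq he
  have h2 := hΔ.lt_blocks h' hr he'
  have h3 : ls.length = q + r := by omega
  rw [h3, mul_add] at hD
  omega

theorem runProd_ne_of_last_ne (hΔ : PowNotMemBlocks k) (hk : 2 ≤ k) {b : Bool} {ls ls' : List ℕ}
    (h : RunsValid k ls) (h' : RunsValid k ls') (hne : ls ≠ []) (i : ℕ) :
    runProd (2 * k) b ls ≠ runProd (2 * k) (!b) ls' * Ωd (2 * k) ^ i := by
  intro he
  obtain ⟨c, ms, hms, -, hf, -, hp⟩ := exists_complement (!b) h'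
  refine runProd_ne_zpow hΔ hk (b := c) (runsValid_append.2 ⟨hms, h⟩) (by simp [hne])
    ((ls'.length + i : ℕ) : ℤ) ?_
  rw [runProd_append, hf, Bool.not_not, he, mul_assoc,
    ← ((commute_Ωd (runProd (2 * k) c ms)).pow_right i).eq, ← mul_assoc, hp, zpow_natCast, pow_add]

/-- Removing the last letter of a nonempty run decomposition. -/
theorem exists_runProd_eq_mul_letter {b : Bool} {ls : List ℕ} (h : RunsValid k ls)
    (hne : ls ≠ []) : ∃ c ms, RunsValid k ms ∧ ms.sum + 1 = ls.sum ∧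
      runProd (2 * k) b ls = runProd (2 * k) c ms * letter (2 * k) b ∧
      ((c = b ∧ blocks b ls = blocks c ms) ∨
        (c = !b ∧ ms ≠ [] ∧ blocks b ls = blocks c ms + b.toNat)) := by
  obtain _ | ⟨l, ls⟩ := ls
  · exact absurd rfl hne
  obtain ⟨hl, hls⟩ := runsValid_cons.1 h
  obtain _ | _ | l := l
  · omega
  · exact ⟨b, ls, hls, by simp [add_comm], by simp [runProd, altr, firstLetter],
      Or.inl ⟨rfl, by simp [blocks, inc, firstLetter]⟩⟩
  · refine ⟨!b, (l + 1) :: ls, runsValid_cons.2 ⟨by omega, hls⟩, by simp; omega, ?_,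
      Or.inr ⟨rfl, by simp, ?_⟩⟩
    · rw [runProd, altr, runProd, firstLetter, mul_assoc]
    · rw [blocks, blocks, inc, firstLetter]; omega

theorem runProd_unique (hΔ : PowNotMemBlocks k) (hk : 2 ≤ k) {b b' : Bool} {ls ls' : List ℕ}
    (h : RunsValid k ls) (h' : RunsValid k ls') {i : ℕ}
    (he : runProd (2 * k) b ls = runProd (2 * k) b' ls' * Ωd (2 * k) ^ i) :
    i = 0 ∧ (ls' ≠ [] → ls ≠ [] ∧ b = b') := by
  induction hn : ls.sum generalizing b b' ls ls' with
  | zero =>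
    have hls : ls = [] := by
      by_contra hne
      have := h.sum_pos hne
      omega
    have h1 := congrArg (fun x => (len (2 * k) x).toAdd) he
    simp only [len_runProd, map_mul, map_pow, toAdd_mul, toAdd_pow, len_Ωd, nsmul_eq_mul, hn] at h1
    rcases Nat.eq_zero_or_pos i with rfl | hi
    · refine ⟨rfl, fun hne => ?_⟩
      have := h'.sum_pos hne
      rw [Nat.cast_zero, zero_mul] at h1
      omega
    · have : 0 < (i : ℤ) * (2 * k) := by positivity
      omega
  | succ n ih =>
    have hls : ls ≠ [] := by rintro rfl; simp at hn
    by_cases hls' : ls' = []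
    · subst hls'
      refine absurd ?_ (runProd_ne_zpow hΔ hk h hls (i : ℤ) (b := b))
      simpa [runProd] using he
    by_cases hb : b = b'
    · subst hb
      obtain ⟨c, ms, hms, hsum, hc, -⟩ := exists_runProd_eq_mul_letter (b := b) h hls
      obtain ⟨c', ms', hms', -, hc', -⟩ := exists_runProd_eq_mul_letter (b := b) h' hls'
      rw [hc, hc', mul_assoc, ((commute_Ωd (letter (2 * k) b)).pow_right i).eq, ← mul_assoc,
        mul_right_cancel_iff] at he
      exact ⟨(ih hms hms' he (by omega)).1, fun _ => ⟨hls, rfl⟩⟩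
    · obtain rfl : b' = !b := by cases b <;> cases b' <;> simp_all
      exact absurd he (runProd_ne_of_last_ne hΔ hk h h' hls i)

theorem runProd_unmovable (hΔ : PowNotMemBlocks k) (hk : 2 ≤ k) (b : Bool) {ls : List ℕ}
    (h : RunsValid k ls) : Unmovable (Md (2 * k)) (Ωd (2 * k)) (runProd (2 * k) b ls) := by
  refine ⟨runProd_mem _ _ _, fun hle => ?_⟩
  obtain ⟨b', ls', i, h', he⟩ := exists_runProd_of_mem hk hle
  rw [mul_inv_eq_iff_eq_mul, mul_assoc, ← pow_succ] at he
  exact absurd (runProd_unique hΔ hk h h' he).1 (by omega)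

theorem exists_runProd_of_unmovable (hk : 2 ≤ k) {x : DG (2 * k)}
    (hx : Unmovable (Md (2 * k)) (Ωd (2 * k)) x) :
    ∃ b ls, RunsValid k ls ∧ x = runProd (2 * k) b ls := by
  obtain ⟨b, ls, i, h, rfl⟩ := exists_runProd_of_mem hk hx.1
  cases i with
  | zero => exact ⟨b, ls, h, by simp⟩
  | succ i =>
    refine absurd ?_ hx.2
    rw [leR, pow_succ, ← mul_assoc, mul_inv_cancel_right]
    exact mul_mem (runProd_mem _ _ _) (pow_mem Ωd_mem i)

theorem runProd_not_divisible (hΔ : PowNotMemBlocks k) (hk : 2 ≤ k) {b c : Bool} {ls : List ℕ}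
    (h : RunsValid k ls) (hc : ls = [] ∨ b ≠ c) :
    runProd (2 * k) b ls * (letter (2 * k) c)⁻¹ ∉ Md (2 * k) := by
  intro hm
  obtain ⟨b', ls', i, h', he⟩ := exists_runProd_of_mem hk hm
  rw [mul_inv_eq_iff_eq_mul, mul_assoc, ← ((commute_Ωd (letter (2 * k) c)).pow_right i).eq,
    ← mul_assoc] at he
  obtain ⟨b'', ls'', h'', ⟨he', hne, rfl⟩ | he'⟩ := exists_runProd_mul_letter (b := b') hk h' c
  · rw [he'] at he
    have := (runProd_unique hΔ hk h h'' he).2 hne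
    tauto
  · rw [he', mul_assoc, ← pow_succ'] at he
    exact absurd (runProd_unique hΔ hk h h'' he).1 (by omega)

theorem len_nonneg {m : ℕ} {x : DG m} (hx : x ∈ Md m) : 0 ≤ (len m x).toAdd := by
  induction hx using Submonoid.closure_induction with
  | mem x hx =>
    rcases hx with rfl | rfl
    · exact (len_letter m true).symm ▸ zero_le_one
    · exact (len_letter m false).symm ▸ zero_le_one
  | one => simp
  | mul x y _ _ hx hy => rw [map_mul, toAdd_mul]; omega

theorem tail_mem {G : Type*} [Group G] (M N : Submonoid G) (a : G) : tail M N a ∈ N := by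
  unfold tail
  split_ifs with h
  · exact h.choose_spec.1
  · exact one_mem N

theorem mul_pow_inv_mem_iff {m : ℕ} {c : Bool} {a : DG m} (ha : a ∈ Md m)
    (hc : a * (letter m c)⁻¹ ∉ Md m) (p i : ℕ) :
    a * letter m c ^ p * (letter m c ^ i)⁻¹ ∈ Md m ↔ i ≤ p := by
  constructor
  · intro h
    by_contra hlt
    obtain ⟨d, rfl⟩ : ∃ d, i = p + d + 1 := ⟨i - p - 1, by omega⟩
    refine hc ?_
    convert mul_mem h (pow_mem (letter_mem m c) d) using 1
    rw [show p + d + 1 = d + 1 + p by omega, pow_add, mul_inv_rev, mul_assoc a,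
      mul_inv_cancel_left, mul_assoc, pow_succ, mul_inv_rev, inv_mul_cancel_right]
  · intro h
    obtain ⟨d, rfl⟩ := Nat.exists_eq_add_of_le' h
    rw [pow_add, ← mul_assoc, mul_inv_cancel_right]
    exact mul_mem ha (pow_mem (letter_mem m c) d)

theorem one_mul_letter_inv_notMem (m : ℕ) (c : Bool) : 1 * (letter m c)⁻¹ ∉ Md m := by
  intro h
  have := len_nonneg h
  rw [one_mul, map_inv, toAdd_inv, len_letter] at this
  omega

theorem tail_eq_pow {m : ℕ} {c : Bool} {a : DG m} (ha : a ∈ Md m)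
    (hc : a * (letter m c)⁻¹ ∉ Md m) (p : ℕ) :
    tail (Md m) (Submonoid.closure {letter m c}) (a * letter m c ^ p) = letter m c ^ p := by
  have hone (q i : ℕ) : letter m c ^ q * (letter m c ^ i)⁻¹ ∈ Md m ↔ i ≤ q := by
    simpa using mul_pow_inv_mem_iff (one_mem _) (one_mul_letter_inv_notMem m c) q i
  have hex : ∃ b : DG m, b ∈ Submonoid.closure {letter m c} ∧
      {d | d ∈ Submonoid.closure {letter m c} ∧ leR (Md m) d (a * letter m c ^ p)} =
        {d | d ∈ Submonoid.closure {letter m c} ∧ leR (Md m) d b} := by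
    refine ⟨letter m c ^ p, Submonoid.mem_closure_singleton.2 ⟨p, rfl⟩, Set.ext fun d => ?_⟩
    refine and_congr_right fun hd => ?_
    obtain ⟨i, rfl⟩ := Submonoid.mem_closure_singleton.1 hd
    rw [leR, leR, mul_pow_inv_mem_iff ha hc, hone]
  rw [tail, dif_pos hex]
  obtain ⟨h1, h2⟩ := hex.choose_spec
  obtain ⟨q, hq⟩ := Submonoid.mem_closure_singleton.1 h1
  rw [← hq] at h2 ⊢
  have h3 (i : ℕ) : i ≤ p ↔ i ≤ q := by
    have := Set.ext_iff.1 h2 (letter m c ^ i)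
    simp only [Set.mem_ofPred_eq, Submonoid.mem_closure_singleton.2 ⟨i, rfl⟩, true_and, leR,
      mul_pow_inv_mem_iff ha hc, hone] at this
    exact this
  rw [le_antisymm ((h3 p).1 le_rfl) ((h3 q).2 le_rfl)]

/-- The letter removed at the `i`-th stripping step. -/
def stripLetter (i : ℕ) : Bool := decide (i % 2 ≠ 0)

theorem stripLetter_succ (i : ℕ) : stripLetter (i + 1) = !stripLetter i := by
  rcases Nat.mod_two_eq_zero_or_one i with h | h <;> simp [stripLetter, Nat.add_mod, h]

theorem strip_succ (m i : ℕ) (a : DG m) :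
    strip (Md m) (M₁d m) (Nd m) (i + 1) a = strip (Md m) (M₁d m) (Nd m) i a *
      (tail (Md m) (Submonoid.closure {letter m (stripLetter i)})
        (strip (Md m) (M₁d m) (Nd m) i a))⁻¹ := by
  rw [strip]
  rcases Nat.mod_two_eq_zero_or_one i with h | h <;> simp [stripLetter, h, M₁d, Nd]

theorem strip_succ_of_eq {m i p : ℕ} {a x : DG m} (hx : x ∈ Md m)
    (hc : x * (letter m (stripLetter i))⁻¹ ∉ Md m)
    (he : strip (Md m) (M₁d m) (Nd m) i a = x * letter m (stripLetter i) ^ p) :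
    strip (Md m) (M₁d m) (Nd m) (i + 1) a = x := by
  rw [strip_succ, he, tail_eq_pow hx hc, mul_inv_cancel_right]

theorem strip_eq_one_add {m i : ℕ} {a : DG m} (h : strip (Md m) (M₁d m) (Nd m) i a = 1) (n : ℕ) :
    strip (Md m) (M₁d m) (Nd m) (i + n) a = 1 := by
  induction n with
  | zero => exact h
  | succ n ih =>
    exact strip_succ_of_eq (p := 0) (one_mem _) (one_mul_letter_inv_notMem m _) (by simpa using ih)

theorem exists_runProd_eq_mul_pow (b : Bool) {ls : List ℕ} (h : RunsValid k ls) :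
    ∃ p : ℕ, (runProd (2 * k) b ls = letter (2 * k) b ^ p ∧ b.toNat ≤ blocks b ls) ∨
      ∃ ls', RunsValid k ls' ∧ ls' ≠ [] ∧
        runProd (2 * k) b ls = runProd (2 * k) (!b) ls' * letter (2 * k) b ^ p ∧
        blocks b ls = blocks (!b) ls' + b.toNat := by
  induction hn : ls.sum generalizing ls with
  | zero =>
    have hls : ls = [] := by
      by_contra hne
      have := h.sum_pos hne
      omega
    subst hls
    exact ⟨0, Or.inl ⟨by simp [runProd], le_rfl⟩⟩
  | succ n ih =>
    have hls : ls ≠ [] := by rintro rfl; simp at hn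
    obtain ⟨c, ms, hms, hsum, hc, ⟨rfl, hD⟩ | ⟨rfl, hne, hD⟩⟩ :=
      exists_runProd_eq_mul_letter (b := b) h hls
    · obtain ⟨p, ⟨hp, hD'⟩ | ⟨ls', h', hne', hp, hD'⟩⟩ := ih hms (by omega)
      · exact ⟨p + 1, Or.inl ⟨by rw [hc, hp, pow_succ], hD ▸ hD'⟩⟩
      · exact ⟨p + 1, Or.inr ⟨ls', h', hne', by rw [hc, hp, pow_succ, mul_assoc], hD ▸ hD'⟩⟩
    · exact ⟨1, Or.inr ⟨ms, hms, hne, by rw [hc, pow_one], hD⟩⟩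

theorem strip_add_eq_one (hΔ : PowNotMemBlocks k) (hk : 2 ≤ k) {ls : List ℕ}
    (h : RunsValid k ls) {a : DG (2 * k)} {i n : ℕ}
    (he : strip (Md (2 * k)) (M₁d (2 * k)) (Nd (2 * k)) i a =
      runProd (2 * k) (stripLetter i) ls)
    (hn : 2 * blocks (stripLetter i) ls + (!stripLetter i).toNat ≤ n) :
    strip (Md (2 * k)) (M₁d (2 * k)) (Nd (2 * k)) (i + n) a = 1 := by
  have h01 : (stripLetter i).toNat + (!stripLetter i).toNat = 1 := by
    cases stripLetter i <;> rfl
  induction n generalizing i ls with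
  | zero =>
    obtain ⟨p, ⟨-, hD⟩ | ⟨ls', h', hne, hp, hD⟩⟩ := exists_runProd_eq_mul_pow (stripLetter i) h <;>
      omega
  | succ n ih =>
    obtain ⟨p, ⟨hp, hD⟩ | ⟨ls', h', hne, hp, hD⟩⟩ := exists_runProd_eq_mul_pow (stripLetter i) h
    · have := strip_succ_of_eq (p := p) (one_mem _)
        (one_mul_letter_inv_notMem _ _) (he.trans (by rw [hp, one_mul]))
      rw [add_comm n, ← add_assoc]
      exact strip_eq_one_add this n
    · have := strip_succ_of_eq (runProd_mem _ _ _)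
        (runProd_not_divisible hΔ hk h' (Or.inr (by simp))) (he.trans hp)
      rw [← stripLetter_succ] at this
      rw [add_comm n, ← add_assoc]
      refine ih h' this ?_ ?_
      · rw [stripLetter_succ, Bool.not_not]
        omega
      · rw [stripLetter_succ, Bool.not_not]
        omega

theorem bh_le {m p : ℕ} {a : DG m} (hp : 1 ≤ p) (h : strip (Md m) (M₁d m) (Nd m) p a = 1) :
    bh (Md m) (M₁d m) (Nd m) a ≤ p :=
  Nat.sInf_le ⟨hp, h⟩

theorem strip_runProd (hΔ : PowNotMemBlocks k) (hk : 2 ≤ k) (b : Bool) {ls : List ℕ}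
    (h : RunsValid k ls) :
    strip (Md (2 * k)) (M₁d (2 * k)) (Nd (2 * k)) (2 * blocks b ls + 1) (runProd (2 * k) b ls) =
      1 := by
  cases b with
  | false =>
    have := strip_add_eq_one hΔ hk (i := 0) (a := runProd (2 * k) false ls) h rfl le_rfl
    rwa [zero_add] at this
  | true =>
    have h1 := strip_succ_of_eq (i := 0) (p := 0) (a := runProd (2 * k) true ls)
      (runProd_mem (2 * k) true ls) (runProd_not_divisible hΔ hk h (Or.inr (by simp [stripLetter])))
      (by simp [strip])
    have := strip_add_eq_one hΔ hk (i := 1) h h1 le_rfl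
    rwa [add_comm] at this

theorem dpt_runProd_le (hΔ : PowNotMemBlocks k) (hk : 2 ≤ k) (b : Bool) {ls : List ℕ}
    (h : RunsValid k ls) :
    dpt (Md (2 * k)) (M₁d (2 * k)) (Nd (2 * k)) (runProd (2 * k) b ls) ≤ blocks b ls := by
  have := bh_le (by omega) (strip_runProd hΔ hk b h)
  rw [dpt]
  omega

theorem exists_eq_strip_mul (m n : ℕ) (a : DG m) :
    ∃ x ∈ blockSet m (n / 2), a = strip (Md m) (M₁d m) (Nd m) n a * x := by
  induction n with
  | zero => exact ⟨1, ⟨0, by simp⟩, by simp [strip]⟩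
  | succ n ih =>
    obtain ⟨x, hx, he⟩ := ih
    have ht := tail_mem (Md m) (Submonoid.closure {letter m (stripLetter n)})
      (strip (Md m) (M₁d m) (Nd m) n a)
    obtain ⟨q, hq⟩ := Submonoid.mem_closure_singleton.1 ht
    refine ⟨letter m (stripLetter n) ^ q * x, ?_, ?_⟩
    · rcases Nat.mod_two_eq_zero_or_one n with h | h
      · rw [show (n + 1) / 2 = n / 2 by omega]
        simp only [stripLetter, h]
        cases hd : n / 2 with
        | zero =>
          rw [hd] at hx
          obtain ⟨z, rfl⟩ := hx
          exact ⟨q + z, by simp [zpow_add]⟩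
        | succ d =>
          rw [hd] at hx
          obtain ⟨z, w, y, hy, rfl⟩ := hx
          exact ⟨q + z, w, y, hy, by simp [zpow_add, mul_assoc]⟩
      · rw [show (n + 1) / 2 = n / 2 + 1 by omega]
        exact ⟨0, q, x, hx, by simp [stripLetter, h]⟩
    · rw [strip_succ, ← hq, ← mul_assoc, inv_mul_cancel_right]
      exact he

theorem mem_blockSet_dpt {m p : ℕ} {a : DG m} (hp : 1 ≤ p)
    (h : strip (Md m) (M₁d m) (Nd m) p a = 1) :
    a ∈ blockSet m (dpt (Md m) (M₁d m) (Nd m) a) := by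
  have h1 : strip (Md m) (M₁d m) (Nd m) (bh (Md m) (M₁d m) (Nd m) a) a = 1 :=
    (Nat.sInf_mem (s := {p : ℕ | 1 ≤ p ∧ strip (Md m) (M₁d m) (Nd m) p a = 1}) ⟨p, hp, h⟩).2
  obtain ⟨x, hx, he⟩ := exists_eq_strip_mul m (bh (Md m) (M₁d m) (Nd m) a) a
  rw [h1, one_mul] at he
  rw [dpt]
  exact he.symm ▸ hx

theorem runProd_replicate (hk : 2 ≤ k) (j : ℕ) :
    runProd (2 * k) true (List.replicate j (2 * k - 1)) =
        altr (2 * k) true (2 * k - 1) ^ j ∧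
      blocks true (List.replicate j (2 * k - 1)) = (k - 1) * j + 1 := by
  have h1 : firstLetter true (2 * k - 1) = true := by
    rw [firstLetter_eq, show (2 * k - 1) % 2 = 1 by omega]; rfl
  have h2 : inc true (2 * k - 1) = k - 1 := by
    have h3 := inc_add (b := true) (l := 2 * k - 1) (by omega)
    have h4 := count_two_mul false k
    obtain ⟨q, hq⟩ : ∃ q, 2 * k = q + 1 := ⟨2 * k - 1, by omega⟩
    rw [hq, count] at h4
    rw [h1, show 2 * k - 1 = q by omega] at h3
    rw [show 2 * k - 1 = q by omega]
    simp at h3 h4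
    omega
  induction j with
  | zero => exact ⟨by simp [runProd], by simp [blocks]⟩
  | succ j ih =>
    rw [List.replicate_succ, runProd, blocks, h1, h2, ih.1, ih.2, pow_succ]
    exact ⟨rfl, by ring⟩

theorem strip_Ωd_pow (hΔ : PowNotMemBlocks k) (hk : 2 ≤ k) (j : ℕ) :
    strip (Md (2 * k)) (M₁d (2 * k)) (Nd (2 * k)) (2 * ((k - 1) * j + 1) + 1) (Ωd (2 * k) ^ j) =
      1 := by
  obtain ⟨h1, h2⟩ := runProd_replicate hk j
  have hv : RunsValid k (List.replicate j (2 * k - 1)) := by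
    intro l hl
    obtain rfl := (List.mem_replicate.1 hl).2
    omega
  have hΩ : Ωd (2 * k) = altr (2 * k) true (2 * k - 1) * letter (2 * k) false := by
    rw [← altr_full false, show altr (2 * k) true (2 * k - 1) * letter (2 * k) false =
      altr (2 * k) false (2 * k - 1 + 1) from rfl, Nat.sub_add_cancel (by omega)]
  have hcomm : Commute (altr (2 * k) true (2 * k - 1)) (letter (2 * k) false) := by
    rw [← mul_inv_eq_iff_eq_mul.2 hΩ]
    exact (letter_commute_Ωd false).symm.mul_left (Commute.refl _).inv_left
  have h3 := strip_succ_of_eq (i := 0) (p := j) (a := Ωd (2 * k) ^ j)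
    (runProd_mem (2 * k) true (List.replicate j (2 * k - 1)))
    (runProd_not_divisible hΔ hk hv (Or.inr (by simp [stripLetter])))
    (by rw [strip, h1, hΩ, hcomm.mul_pow]; rfl)
  have := strip_add_eq_one hΔ hk (i := 1) hv h3 le_rfl
  rw [show stripLetter 1 = true from rfl, h2] at this
  rwa [add_comm] at this

theorem dpt_Ωd_pow (hΔ : PowNotMemBlocks k) (hk : 2 ≤ k) {j : ℕ} (hj : 1 ≤ j) :
    dpt (Md (2 * k)) (M₁d (2 * k)) (Nd (2 * k)) (Ωd (2 * k) ^ j) = (k - 1) * j + 1 := by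
  have h1 := bh_le (by omega) (strip_Ωd_pow hΔ hk j)
  have h2 := mem_blockSet_dpt (by omega) (strip_Ωd_pow hΔ hk j)
  refine le_antisymm (by rw [dpt]; omega) ?_
  by_contra hlt
  exact hΔ j hj (blockSet_mono _ (by omega) h2)

end DihedralArtin

namespace DihedralArtin

open BraidOrder

theorem map_mul_pow_inv_mem_S1Neg {k : ℕ} {ι : DG (2 * k) →* Braid (2 * k)} (hk : 2 ≤ k)
    (hs : ι (sA (2 * k)) = stepProd (2 * k) 0 k)
    (ht : ι (tA (2 * k)) = stepProd (2 * k) 1 (k - 1)) {j : ℕ} (hj : 1 ≤ j)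
    {x : DG (2 * k)} (hx : x ∈ blockSet (2 * k) ((k - 1) * j)) :
    ι (x * (Ωd (2 * k) ^ j)⁻¹) ∈ S1Neg (2 * k) := by
  induction j, hj using Nat.le_induction generalizing x with
  | base =>
    rw [mul_one] at hx
    rw [pow_one, Ωd_eq]
    exact map_mul_inv_mem_S1Neg hk hs ht hx
  | succ j hj ih =>
    obtain ⟨y, hy, z, hz, rfl⟩ := exists_mul_of_mem_blockSet_add hx
    have hz' := map_mul_inv_mem_S1Neg hk hs ht hz
    rw [← Ωd_eq] at hz'
    have := S1Neg_mul (ih hy) hz'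
    rw [← map_mul, mul_assoc, ← mul_assoc _ z, ← ((commute_Ωd z).pow_right j).inv_right.eq,
      mul_assoc z, ← mul_inv_rev, ← pow_succ', ← mul_assoc] at this
    exact this

theorem map_mem_G₁b {k : ℕ} {ι : DG (2 * k) →* Braid (2 * k)}
    (ht : ι (tA (2 * k)) = stepProd (2 * k) 1 (k - 1)) {x : DG (2 * k)}
    (hx : x ∈ blockSet (2 * k) 0) : ι x ∈ G₁b (2 * k) := by
  obtain ⟨a, rfl⟩ := hx
  rw [map_zpow, ht]
  refine zpow_mem (Subgroup.list_prod_mem _ fun y hy => ?_) a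
  obtain ⟨i, rfl⟩ := List.mem_ofFn.1 hy
  exact Subgroup.subset_closure ⟨_, by omega, by omega, rfl⟩

theorem powNotMemBlocks {k : ℕ} {ι : DG (2 * k) →* Braid (2 * k)} (hk : 2 ≤ k)
    (hs : ι (sA (2 * k)) = stepProd (2 * k) 0 k)
    (ht : ι (tA (2 * k)) = stepProd (2 * k) 1 (k - 1)) : PowNotMemBlocks k := by
  intro j hj hmem
  have := map_mul_pow_inv_mem_S1Neg hk hs ht hj hmem
  rw [mul_inv_cancel, map_one] at this
  exact not_mem_S1Neg_of_mem (by omega) (one_mem _) this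

theorem map_notMem_S1Neg {k : ℕ} {ι : DG (2 * k) →* Braid (2 * k)} (hk : 2 ≤ k)
    (hs : ι (sA (2 * k)) = stepProd (2 * k) 0 k)
    (ht : ι (tA (2 * k)) = stepProd (2 * k) 1 (k - 1)) {b : Bool} {ls : List ℕ}
    (h : RunsValid k ls) {j : ℤ} (hj : ((k - 1 : ℕ) : ℤ) * j + 1 ≤ blocks b ls) :
    ι (runProd (2 * k) b ls * (Ωd (2 * k) ^ j)⁻¹) ∉ S1Neg (2 * k) := by
  intro hneg
  obtain ⟨b', ls', h', -, -, hD, hp⟩ := exists_complement b h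
  have hinv : (runProd (2 * k) b ls * (Ωd (2 * k) ^ j)⁻¹)⁻¹ =
      runProd (2 * k) b' ls' * (Ωd (2 * k) ^ ((ls.length : ℤ) - j))⁻¹ := by
    rw [inv_eq_iff_mul_eq_one, mul_assoc, ← mul_assoc _ (runProd (2 * k) b' ls'),
      ← ((commute_Ωd (runProd (2 * k) b' ls')).zpow_right j).inv_right.eq, mul_assoc, ← mul_assoc,
      hp, ← zpow_natCast]
    group
  have hmem := runProd_mem_blockSet (m := 2 * k) (b := b') h'
  have hle : (blocks b' ls' : ℤ) ≤ ((k - 1 : ℕ) : ℤ) * ((ls.length : ℤ) - j) := by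
    have : (blocks b ls : ℤ) + blocks b' ls' = ((k - 1 : ℕ) : ℤ) * ls.length + 1 := by
      exact_mod_cast hD
    rw [mul_sub]
    omega
  have hk1 : (0 : ℤ) < ((k - 1 : ℕ) : ℤ) := by omega
  have hr : 0 ≤ (ls.length : ℤ) - j :=
    nonneg_of_mul_nonneg_right (le_trans (by positivity) hle) hk1
  obtain ⟨r, hr'⟩ := Int.eq_ofNat_of_zero_le hr
  rw [hr'] at hle hinv
  rw [zpow_natCast] at hinv
  rcases Nat.eq_zero_or_pos r with rfl | hr0
  · rw [pow_zero, inv_one, mul_one, inv_eq_iff_eq_inv] at hinv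
    have h0 : blocks b' ls' = 0 := by
      rw [Nat.cast_zero, mul_zero] at hle
      omega
    rw [h0] at hmem
    rw [hinv, map_inv] at hneg
    exact not_mem_S1Neg_of_mem (by omega) (inv_mem (map_mem_G₁b ht hmem)) hneg
  · have := S1Neg_mul hneg (map_mul_pow_inv_mem_S1Neg hk hs ht hr0
      (blockSet_mono _ (by exact_mod_cast hle) hmem))
    rw [← hinv, ← map_mul, mul_inv_cancel, map_one] at this
    exact not_mem_S1Neg_of_mem (by omega) (one_mem _) this

end DihedralArtin

open GarsideOrder BraidOrder DihedralArtin in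
/-- Let `m = 2k` be even (`m ≥ 4`) and let `ι : A(I₂(m)) → B_{2k}` be Crisp's injective
homomorphism, `ι(s) = r₁ r₃ ⋯ r_{2k-1}`, `ι(t) = r₂ r₄ ⋯ r_{2k-2}`. Then `α ∈ A(I₂(m))`
is `(H, G₁)`-negative if and only if `ι(α)` is `r₁`-negative. -/
theorem statement18 (k : ℕ) (hk : 2 ≤ k)
    (ι : DG (2 * k) →* Braid (2 * k))
    (hs : ι (sA (2 * k)) = (List.ofFn (fun j : Fin k => gen (2 * k) (2 * (j : ℕ)))).prod)
    (ht : ι (tA (2 * k)) =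
      (List.ofFn (fun j : Fin (k - 1) => gen (2 * k) (2 * (j : ℕ) + 1))).prod)
    (hinj : Function.Injective ι) :
    ∀ α : DG (2 * k),
      Negative (Md (2 * k)) (M₁d (2 * k)) (Nd (2 * k)) (Ωd (2 * k)) α ↔
        ι α ∈ S1Neg (2 * k) := by
  have hs' : ι (sA (2 * k)) = stepProd (2 * k) 0 k := hs
  have ht' : ι (tA (2 * k)) = stepProd (2 * k) 1 (k - 1) := ht
  have hΔ := powNotMemBlocks hk hs' ht'
  intro α
  constructor
  · rintro ⟨a, j, ha, hj, rfl, hlt⟩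
    obtain ⟨b, ls, h, rfl⟩ := exists_runProd_of_unmovable hk ha
    rw [dpt_Ωd_pow hΔ hk hj] at hlt
    exact map_mul_pow_inv_mem_S1Neg hk hs' ht' hj (blockSet_mono _ (Nat.lt_succ_iff.1 hlt)
      (mem_blockSet_dpt (by omega) (strip_runProd hΔ hk b h)))
  · intro hneg
    obtain ⟨b, ls, j, h, rfl⟩ := exists_runProd hk α
    have hlt : (blocks b ls : ℤ) < ((k - 1 : ℕ) : ℤ) * j + 1 :=
      not_le.1 fun hle => map_notMem_S1Neg hk hs' ht' h hle hneg
    have hj : 0 ≤ j := by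
      have h1 : (0 : ℤ) ≤ ((k - 1 : ℕ) : ℤ) * j := by omega
      exact nonneg_of_mul_nonneg_right h1 (by omega)
    lift j to ℕ using hj
    rcases Nat.eq_zero_or_pos j with rfl | hj
    · have h0 : blocks b ls = 0 := by
        rw [Nat.cast_zero, mul_zero] at hlt
        omega
      have hmem := runProd_mem_blockSet (m := 2 * k) (b := b) h
      rw [h0] at hmem
      rw [Nat.cast_zero, zpow_zero, inv_one, mul_one] at hneg
      exact absurd hneg (not_mem_S1Neg_of_mem (by omega) (map_mem_G₁b ht' hmem))
    · refine ⟨_, j, runProd_unmovable hΔ hk b h, hj, by rw [zpow_natCast], ?_⟩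
      rw [dpt_Ωd_pow hΔ hk hj]
      exact (dpt_runProd_le hΔ hk b h).trans_lt (by exact_mod_cast hlt)
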